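/- arXiv:1910.02465 — 3 statements merged into one kernel-verified Lean document; each statement's English description precedes it below -/
import Mathlib

section
/- There is a constant c > 0 such that the following holds. Let n ≥ 4 and 2 ≤ b ≤ n/2 be integers, and let F be a field whose characteristic is either 0 or a prime p not dividing b. Then for every ε ∈ (1/2^n, 1/(3b)) there exists i ∈ {0,…,b−1} such that pdeg^F_ε(MOD_n^{b,i}) ≥ c·√(n·log(1/(bε))). -/
noncomputable section

open scoped BigOperators

/-- Embed a Boolean value into a field: `true ↦ 1`, `false ↦ 0`. -/
def bF (F : Type) [Field F] (b : Bool) : F := if b then 1 else 0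

/-- A finitely supported probability distribution on polynomials in
`F[x_1,…,x_n]` (a probabilistic polynomial). -/
structure ProbPoly (F : Type) [Field F] (n : ℕ) where
  k : ℕ
  w : Fin k → ℝ
  w_nonneg : ∀ i, 0 ≤ w i
  w_sum : ∑ i, w i = 1
  poly : Fin k → MvPolynomial (Fin n) F

open Classical in
/-- The probability that the probabilistic polynomial `P` errs on input `a`
with respect to the Boolean function `f`. -/
def errAt {F : Type} [Field F] {n : ℕ} (P : ProbPoly F n)
    (f : (Fin n → Bool) → Bool) (a : Fin n → Bool) : ℝ :=
  ∑ i, if MvPolynomial.eval (fun v => bF F (a v)) (P.poly i) = bF F (f a) then 0 else P.w i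

/-- The ε-error probabilistic degree of a Boolean function over `F`: the least `d`
such that some probabilistic polynomial of degree at most `d` computes `f` with
error at most `ε` at each point. -/
def pdeg (F : Type) [Field F] {n : ℕ} (f : (Fin n → Bool) → Bool) (ε : ℝ) : ℕ :=
  sInf {d | ∃ P : ProbPoly F n, (∀ i, (P.poly i).totalDegree ≤ d) ∧ ∀ a, errAt P f a ≤ ε}

/-- Hamming weight of a Boolean input. -/
def wt {n : ℕ} (a : Fin n → Bool) : ℕ := (Finset.univ.filter fun i => a i = true).card

/-- The period of a spectrum: the least `b ≥ 1` with `spec i = spec (i+b)`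
whenever `i + b ≤ n`. -/
def period (n : ℕ) (spec : ℕ → Bool) : ℕ :=
  sInf {b | 1 ≤ b ∧ ∀ i, i + b ≤ n → spec i = spec (i + b)}

/-- `B(f)`: the least `k` such that the spectrum is constant on `[k, n-k]`. -/
def Bparam (n : ℕ) (spec : ℕ → Bool) : ℕ :=
  sInf {k | ∀ i j, k ≤ i → i + k ≤ n → k ≤ j → j + k ≤ n → spec i = spec j}


lemma card_small_subsets (n k : ℕ) :
    ((Finset.univ : Finset (Finset (Fin n))).filter (fun T => T.card ≤ k)).card
      = ∑ j ∈ Finset.range (k+1), n.choose j := by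
  classical
  rw [Finset.card_eq_sum_card_fiberwise (f := Finset.card) (t := Finset.range (k+1))]
  · apply Finset.sum_congr rfl
    intro j hj
    have : (({T ∈ (Finset.univ : Finset (Finset (Fin n))) | T.card ≤ k}).filter (fun T => T.card = j))
        = Finset.powersetCard j Finset.univ := by
      ext T
      simp only [Finset.mem_range] at hj
      simp [Finset.mem_powersetCard]
      omega
    rw [this, Finset.card_powersetCard]
    simp
  · intro T hT
    simp at hT ⊢
    omega

open Classical in
lemma poly_mem_span {K : Type} [Field K] {n k : ℕ} (S : Finset (Fin n → Bool))
    (p : MvPolynomial (Fin n) K) (hp : p.totalDegree ≤ k) :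
    (fun a : S => MvPolynomial.eval (fun v => bF K (a.1 v)) p) ∈
      Submodule.span K (((Finset.univ : Finset (Finset (Fin n))).filter (fun T => T.card ≤ k)).image
        (fun T => (fun a : S => ∏ i ∈ T, bF K (a.1 i))) : Set (S → K)) := by
  classical
  have h : (fun a : S => MvPolynomial.eval (fun v => bF K (a.1 v)) p)
      = ∑ e ∈ p.support, p.coeff e • (fun a : S => ∏ i ∈ e.support, bF K (a.1 i)) := by
    funext a
    rw [MvPolynomial.eval_eq, Finset.sum_apply]
    apply Finset.sum_congr rfl
    intro e he
    simp only [Pi.smul_apply, smul_eq_mul]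
    congr 1
    apply Finset.prod_congr rfl
    intro i hi
    have : e i ≠ 0 := by simpa using hi
    unfold bF
    split_ifs
    · simp
    · simp [this]
  rw [h]
  apply Submodule.sum_mem
  intro e he
  apply Submodule.smul_mem
  apply Submodule.subset_span
  simp only [Finset.coe_image, Set.mem_image]
  refine ⟨e.support, ?_, rfl⟩
  simp only [Finset.coe_filter, Finset.mem_univ, true_and, Set.mem_ofPred_eq]
  have h1 := MvPolynomial.le_totalDegree he
  have h2 : e.support.card ≤ e.sum fun _ x => x := by
    rw [Finsupp.sum, Finset.card_eq_sum_ones]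
    apply Finset.sum_le_sum
    intro i hi
    have : e i ≠ 0 := by simpa using hi
    omega
  omega

/-- product of linear forms `∏ (1 + c x_i)` -/
def linProd {K : Type} [Field K] {n : ℕ} (c : K) (T : Finset (Fin n)) : MvPolynomial (Fin n) K :=
  ∏ i ∈ T, (1 + MvPolynomial.C c * MvPolynomial.X i)

lemma linProd_deg {K : Type} [Field K] {n : ℕ} (c : K) (T : Finset (Fin n)) :
    (linProd c T).totalDegree ≤ T.card := by
  unfold linProd
  refine (MvPolynomial.totalDegree_finsetProd _ _).trans ?_
  rw [Finset.card_eq_sum_ones]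
  apply Finset.sum_le_sum
  intro i hi
  refine (MvPolynomial.totalDegree_add _ _).trans ?_
  refine max_le (by simp) ?_
  refine (MvPolynomial.totalDegree_mul _ _).trans ?_
  simp

lemma linProd_eval {K : Type} [Field K] {n : ℕ} (w : K) (T : Finset (Fin n)) (a : Fin n → Bool) :
    MvPolynomial.eval (fun v => bF K (a v)) (linProd (w - 1) T)
      = ∏ i ∈ T, (if a i then w else 1) := by
  unfold linProd
  rw [map_prod]
  apply Finset.prod_congr rfl
  intro i hi
  unfold bF
  by_cases h : a i <;> simp [h]

lemma pow_wt {K : Type} [Field K] {n : ℕ} (w : K) (a : Fin n → Bool) :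
    w ^ (wt a) = ∏ i, (if a i then w else 1) := by
  unfold wt
  rw [Finset.prod_ite]
  simp

lemma smolensky {K : Type} [Field K] {n d : ℕ} (w : K) (hw0 : w ≠ 0) (hw1 : w ≠ 1)
    (S : Finset (Fin n → Bool)) (Q : MvPolynomial (Fin n) K) (hQ : Q.totalDegree ≤ d)
    (hS : ∀ a ∈ S, MvPolynomial.eval (fun v => bF K (a v)) Q = w ^ (wt a)) :
    S.card ≤ ∑ j ∈ Finset.range (n / 2 + d + 1), n.choose j := by
  classical
  rw [← card_small_subsets]
  set G : Finset (S → K) :=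
    (((Finset.univ : Finset (Finset (Fin n))).filter (fun T => T.card ≤ n / 2 + d)).image
        (fun T => (fun a : S => ∏ i ∈ T, bF K (a.1 i)))) with hG
  have hy : ∀ T : Finset (Fin n), (fun a : S => ∏ i ∈ T, (if a.1 i then w else 1)) ∈
      Submodule.span K (G : Set (S → K)) := by
    intro T
    by_cases hT : T.card ≤ n / 2
    · have := poly_mem_span (k := n / 2 + d) S (linProd (w - 1) T)
        ((linProd_deg _ _).trans (by omega))
      simp only [linProd_eval] at this
      exact this
    · have hc : Tᶜ.card ≤ n / 2 := by
        rw [Finset.card_compl, Fintype.card_fin]; omega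
      have := poly_mem_span (k := n / 2 + d) S (Q * linProd (w⁻¹ - 1) Tᶜ)
        ((MvPolynomial.totalDegree_mul _ _).trans (by
          have := linProd_deg (w⁻¹ - 1) Tᶜ
          omega))
      have heq : (fun a : S => ∏ i ∈ T, (if a.1 i then w else 1)) = fun a : S =>
          MvPolynomial.eval (fun v => bF K (a.1 v)) (Q * linProd (w⁻¹ - 1) Tᶜ) := by
        funext a
        rw [map_mul, linProd_eval, hS a.1 a.2, pow_wt, ← Finset.prod_mul_prod_compl T, mul_assoc,
          ← Finset.prod_mul_distrib]
        rw [Finset.prod_congr rfl (g := fun _ => (1:K)) (s₁ := Tᶜ)]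
        · simp
        · intro i _
          by_cases h : a.1 i <;> simp [h, hw0]
      rw [heq]
      exact this
  have hw : w - 1 ≠ 0 := sub_ne_zero.mpr hw1
  have htop : Submodule.span K (G : Set (S → K)) = ⊤ := by
    rw [eq_top_iff]
    intro g _
    rw [← Finset.univ_sum_single g]
    apply Submodule.sum_mem
    intro s _
    have hs : (Pi.single s (g s) : S → K) =
        ∑ T ∈ (Finset.univ : Finset (Fin n)).powerset,
          (g s * ((∏ i ∈ T, (if s.1 i then (w-1)⁻¹ else -(w-1)⁻¹)) *
            ∏ i ∈ Finset.univ \ T, (if s.1 i then -(w-1)⁻¹ else w * (w-1)⁻¹))) •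
          (fun a : S => ∏ i ∈ T, (if a.1 i then w else 1)) := by
      funext a
      have hexp : (Pi.single s (g s) : S → K) a = g s * ∏ i, ((if s.1 i then (w-1)⁻¹ else -(w-1)⁻¹)
          * (if a.1 i then w else 1) + (if s.1 i then -(w-1)⁻¹ else w * (w-1)⁻¹)) := by
        by_cases has : a = s
        · subst has
          rw [Pi.single_eq_same, Finset.prod_eq_one, mul_one]
          intro i _
          by_cases h : a.1 i <;> simp [h] <;> field_simp <;> ring
        · rw [Pi.single_eq_of_ne has]
          have : ∃ i, a.1 i ≠ s.1 i := by
            by_contra hcon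
            push Not at hcon
            exact has (Subtype.ext (funext hcon))
          obtain ⟨i, hi⟩ := this
          rw [Finset.prod_eq_zero (Finset.mem_univ i), mul_zero]
          by_cases h : a.1 i <;> by_cases h' : s.1 i <;> simp_all [mul_comm]
      rw [hexp, Finset.prod_add, Finset.sum_apply, Finset.mul_sum]
      apply Finset.sum_congr rfl
      intro T _
      simp only [Pi.smul_apply, smul_eq_mul, Finset.prod_mul_distrib]
      ring
    rw [hs]
    exact Submodule.sum_mem _ fun T _ => Submodule.smul_mem _ _ (hy T)
  have h1 : Module.finrank K (S → K) = S.card := by simp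
  have h2 := finrank_span_finset_le_card (R := K) G
  rw [Set.finrank, htop, finrank_top, h1] at h2
  exact h2.trans Finset.card_image_le

lemma exists_good {F : Type} [Field F] {n : ℕ} (P : ProbPoly F n)
    (f : (Fin n → Bool) → Bool) (ε : ℝ) (h : ∀ a, errAt P f a ≤ ε) :
    ∃ i, ∃ B : Finset (Fin n → Bool), (B.card : ℝ) ≤ ε * 2 ^ n ∧
      ∀ a ∉ B, MvPolynomial.eval (fun v => bF F (a v)) (P.poly i) = bF F (f a) := by
  classical
  by_contra hcon
  push Not at hcon
  let B : Fin P.k → Finset (Fin n → Bool) := fun i => Finset.univ.filter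
    (fun a => ¬ MvPolynomial.eval (fun v => bF F (a v)) (P.poly i) = bF F (f a))
  have hB : ∀ i, ε * 2 ^ n < (B i).card := by
    intro i
    by_contra hlt
    obtain ⟨a, ha, ha'⟩ := hcon i (B i) (not_lt.mp hlt)
    exact ha (by simp [B, ha'])
  have h1 : ∑ a, errAt P f a ≤ ε * 2 ^ n := by
    calc ∑ a, errAt P f a ≤ ∑ a : Fin n → Bool, ε := Finset.sum_le_sum fun a _ => h a
      _ = ε * 2 ^ n := by simp [mul_comm]
  have h2 : ∑ a, errAt P f a = ∑ i, P.w i * (B i).card := by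
    unfold errAt
    rw [Finset.sum_comm]
    apply Finset.sum_congr rfl
    intro i _
    simp only [B, Finset.card_filter]
    push_cast
    rw [Finset.mul_sum]
    apply Finset.sum_congr rfl
    intro a _
    by_cases h : MvPolynomial.eval (fun v => bF F (a v)) (P.poly i) = bF F (f a) <;> simp [h]
  have h3 : ∑ i, P.w i * (ε * 2 ^ n) < ∑ i, P.w i * (B i).card := by
    apply Finset.sum_lt_sum
    · intro i _
      exact mul_le_mul_of_nonneg_left (hB i).le (P.w_nonneg i)
    · by_contra hz
      push Not at hz
      have : ∑ i, P.w i ≤ 0 := by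
        apply Finset.sum_nonpos
        intro i hi
        have := hz i hi
        have h4 := hB i
        by_contra hp
        push Not at hp
        have := mul_lt_mul_of_pos_left h4 hp
        linarith
      rw [P.w_sum] at this
      linarith
  rw [← Finset.sum_mul, P.w_sum] at h3
  linarith

lemma pdeg_nonempty (F : Type) [Field F] {n : ℕ} (f : (Fin n → Bool) → Bool) {ε : ℝ} (hε : 0 ≤ ε) :
    {d | ∃ P : ProbPoly F n, (∀ i, (P.poly i).totalDegree ≤ d) ∧ ∀ a, errAt P f a ≤ ε}.Nonempty := by
  classical
  let q : MvPolynomial (Fin n) F := ∑ s : Fin n → Bool, MvPolynomial.C (bF F (f s)) *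
    ∏ i, (if s i then MvPolynomial.X i else 1 - MvPolynomial.X i)
  refine ⟨q.totalDegree, ⟨1, fun _ => 1, fun _ => zero_le_one, by simp, fun _ => q⟩, fun _ => le_rfl, ?_⟩
  intro a
  have hq : MvPolynomial.eval (fun v => bF F (a v)) q = bF F (f a) := by
    simp only [q, map_sum, map_mul, map_prod, MvPolynomial.eval_C]
    rw [Finset.sum_eq_single a]
    · rw [Finset.prod_eq_one, mul_one]
      intro i _
      by_cases h : a i <;> simp [h, bF]
    · intro s _ hs
      have : ∃ i, s i ≠ a i := by
        by_contra hcon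
        push Not at hcon
        exact hs (funext hcon)
      obtain ⟨i, hi⟩ := this
      rw [Finset.prod_eq_zero (Finset.mem_univ i), mul_zero]
      by_cases h : a i <;> by_cases h' : s i <;> simp_all [bF]
    · simp
  simp [errAt, hq, hε]

lemma pdeg_spec (F : Type) [Field F] {n : ℕ} (f : (Fin n → Bool) → Bool) {ε : ℝ} (hε : 0 ≤ ε) :
    ∃ P : ProbPoly F n, (∀ i, (P.poly i).totalDegree ≤ pdeg F f ε) ∧ ∀ a, errAt P f a ≤ ε :=
  Nat.sInf_mem (pdeg_nonempty F f hε)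

lemma pdeg_pos (F : Type) [Field F] {n : ℕ} (f : (Fin n → Bool) → Bool) {ε : ℝ} (hε : 0 ≤ ε)
    (hε2 : ε < 1 / 2) (a a' : Fin n → Bool) (h : f a ≠ f a') : 1 ≤ pdeg F f ε := by
  classical
  by_contra h0
  obtain ⟨P, hP, hPe⟩ := pdeg_spec F f hε
  have hc : ∀ i, ∃ c, P.poly i = MvPolynomial.C c := fun i =>
    ⟨_, (MvPolynomial.totalDegree_eq_zero_iff_eq_C).1 (by have := hP i; omega)⟩
  choose c hc using hc
  have h1 := hPe a
  have h2 := hPe a'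
  have hne : bF F (f a) ≠ bF F (f a') := by
    unfold bF
    cases h3 : f a <;> cases h4 : f a' <;> simp_all
  have : (1:ℝ) ≤ errAt P f a + errAt P f a' := by
    rw [← P.w_sum]
    unfold errAt
    rw [← Finset.sum_add_distrib]
    apply Finset.sum_le_sum
    intro i _
    simp only [hc, MvPolynomial.eval_C]
    have := P.w_nonneg i
    split_ifs with h5 h6
    · exact absurd (h5.symm.trans h6) hne
    all_goals linarith
  linarith

lemma algebraic_part {n b d : ℕ} (hb : 2 ≤ b) (F : Type) [Field F] (hbF : (b : F) ≠ 0) {ε : ℝ}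
    (hε : 0 ≤ ε)
    (hd : ∀ i < b, pdeg F (fun a : Fin n → Bool => decide (wt a % b = i)) ε ≤ d) :
    (2:ℝ) ^ n - b * ε * 2 ^ n ≤ ∑ j ∈ Finset.range (n / 2 + d + 1), (n.choose j : ℝ) := by
  classical
  let K := AlgebraicClosure F
  have : NeZero (b : K) := ⟨by
    have := (algebraMap F K).injective.ne hbF
    simpa using this⟩
  obtain ⟨w, hw⟩ := HasEnoughRootsOfUnity.exists_primitiveRoot K b
  have hw1 : w ≠ 1 := hw.ne_one (by omega)
  have hw0 : w ≠ 0 := hw.ne_zero (by omega)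
  have hex : ∀ i : Fin b, ∃ q : MvPolynomial (Fin n) F, q.totalDegree ≤ d ∧
      ∃ B : Finset (Fin n → Bool), (B.card : ℝ) ≤ ε * 2 ^ n ∧
      ∀ a ∉ B, MvPolynomial.eval (fun v => bF F (a v)) q = bF F (decide (wt a % b = i)) := by
    intro i
    obtain ⟨P, hP, hPe⟩ := pdeg_spec F (fun a : Fin n → Bool => decide (wt a % b = i)) hε
    obtain ⟨k, B, hB, hB'⟩ := exists_good P _ ε hPe
    exact ⟨P.poly k, (hP k).trans (hd i i.2), B, hB, hB'⟩
  choose q hq B hB hBe using hex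
  let Q : MvPolynomial (Fin n) K := ∑ i : Fin b,
    MvPolynomial.C (w ^ (i:ℕ)) * MvPolynomial.map (algebraMap F K) (q i)
  have hQ : Q.totalDegree ≤ d := by
    apply (MvPolynomial.totalDegree_finsetSum _ _).trans
    apply Finset.sup_le
    intro i _
    refine (MvPolynomial.totalDegree_mul _ _).trans ?_
    have h1 : (MvPolynomial.map (algebraMap F K) (q i)).totalDegree ≤ (q i).totalDegree :=
      Finset.sup_mono (MvPolynomial.support_map_subset _ _)
    have := hq i
    simp only [MvPolynomial.totalDegree_C]
    omega
  have hS := smolensky w hw0 hw1 (Finset.univ.biUnion B)ᶜ Q hQ (by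
    intro a ha
    simp only [Finset.mem_compl, Finset.mem_biUnion, Finset.mem_univ, true_and, not_exists] at ha
    have hbv : (fun v => bF K (a v)) = fun v => algebraMap F K (bF F (a v)) := by
      funext v
      unfold bF
      split_ifs <;> simp
    have key : ∀ i : Fin b, MvPolynomial.eval (fun v => bF K (a v))
        (MvPolynomial.map (algebraMap F K) (q i)) = if wt a % b = i then 1 else 0 := by
      intro i
      have h3 := hBe i a (ha i)
      have h4 := MvPolynomial.eval₂_comp (algebraMap F K) (fun v => bF F (a v)) (q i)
      rw [hbv, MvPolynomial.eval_map]
      refine h4.symm.trans ?_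
      rw [h3]
      unfold bF
      by_cases h : wt a % b = i <;> simp [h]
    simp only [Q, map_sum, map_mul, MvPolynomial.eval_C, key]
    rw [Finset.sum_eq_single (⟨wt a % b, Nat.mod_lt _ (by omega)⟩ : Fin b)]
    · simp only [if_true, mul_one]
      rw [hw.eq_orderOf]
      exact pow_mod_orderOf w _
    · intro i _ hi
      rw [if_neg, mul_zero]
      intro h
      exact hi (Fin.ext h.symm)
    · simp)
  have hcard : ((Finset.univ.biUnion B).card : ℝ) ≤ b * ε * 2 ^ n := by
    calc ((Finset.univ.biUnion B).card : ℝ) ≤ ((∑ i, (B i).card : ℕ) : ℝ) := by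
          exact_mod_cast Finset.card_biUnion_le
      _ ≤ ∑ i : Fin b, ε * 2 ^ n := by push_cast; exact Finset.sum_le_sum fun i _ => hB i
      _ = b * ε * 2 ^ n := by simp; ring
  have htot := Finset.card_add_card_compl (Finset.univ.biUnion B)
  have htot' : ((Finset.univ.biUnion B).card : ℝ) + ((Finset.univ.biUnion B)ᶜ.card : ℝ) = 2 ^ n := by
    have h5 : Fintype.card (Fin n → Bool) = 2 ^ n := by simp
    rw [h5] at htot
    exact_mod_cast htot
  have hS' : ((Finset.univ.biUnion B)ᶜ.card : ℝ) ≤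
    ∑ j ∈ Finset.range (n / 2 + d + 1), (n.choose j : ℝ) := by exact_mod_cast hS
  linarith

lemma centralBinom_sq (k : ℕ) : (Nat.centralBinom k) ^ 2 * (2 * k + 1) ≤ 16 ^ k := by
  induction k with
  | zero => simp
  | succ k ih =>
    have h := Nat.succ_mul_centralBinom_succ k
    have h1 : (k+1)^2 * ((Nat.centralBinom (k+1)) ^ 2 * (2 * (k+1) + 1)) ≤ (k+1)^2 * 16 ^ (k+1) := by
      calc (k+1)^2 * ((Nat.centralBinom (k+1)) ^ 2 * (2 * (k+1) + 1))
          = ((k+1) * Nat.centralBinom (k+1))^2 * (2 * k + 3) := by ring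
        _ = (Nat.centralBinom k ^ 2 * (2 * k + 1)) * (4 * (2 * k + 1) * (2 * k + 3)) := by
            rw [h]; ring
        _ ≤ 16 ^ k * (16 * (k+1)^2) := Nat.mul_le_mul ih (by nlinarith)
        _ = (k+1)^2 * 16 ^ (k+1) := by ring
    exact Nat.le_of_mul_le_mul_left h1 (by positivity)

lemma middle_sq (n : ℕ) : (n.choose (n / 2)) ^ 2 * n ≤ 4 ^ n := by
  rcases Nat.even_or_odd' n with ⟨k, rfl | rfl⟩
  · have h := centralBinom_sq k
    rw [Nat.centralBinom_eq_two_mul_choose] at h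
    rw [show 2 * k / 2 = k by omega, pow_mul]
    norm_num
    nlinarith [sq_nonneg ((2*k).choose k)]
  · have h := centralBinom_sq (k+1)
    have h2 : Nat.centralBinom (k+1) = 2 * (2 * k + 1).choose k := by
      rw [Nat.centralBinom_eq_two_mul_choose, show 2 * (k+1) = (2 * k + 1) + 1 by ring,
        Nat.choose_succ_succ, Nat.choose_symm_half]
      ring
    rw [h2] at h
    rw [show (2 * k + 1) / 2 = k by omega, pow_succ 4, pow_mul]
    norm_num
    rw [pow_succ 16] at h
    nlinarith [sq_nonneg ((2*k+1).choose k)]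

/-- upper tail of the binomial coefficients -/
def tailS (n d : ℕ) : ℝ := ∑ j ∈ Finset.Ico (n / 2 + d + 1) (n + 1), (n.choose j : ℝ)

lemma tail_compl (n d : ℕ) (hd : n / 2 + d ≤ n) :
    (∑ j ∈ Finset.range (n / 2 + d + 1), (n.choose j : ℝ)) + tailS n d = 2 ^ n := by
  unfold tailS
  rw [Finset.range_eq_Ico, Finset.sum_Ico_consecutive _ (by omega) (by omega),
    ← Finset.range_eq_Ico]
  exact_mod_cast Nat.sum_range_choose n

lemma tail_refl (n d : ℕ) (hd : n / 2 + d ≤ n) :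
    tailS n d = ∑ j ∈ Finset.range (n - n / 2 - d), (n.choose j : ℝ) := by
  unfold tailS
  rw [Finset.range_eq_Ico]
  have := Finset.sum_Ico_reflect (fun j => (n.choose j : ℝ)) 0 (m := n - n/2 - d) (n := n) (by omega)
  rw [show n + 1 - (n - n / 2 - d) = n / 2 + d + 1 by omega, Nat.sub_zero] at this
  rw [← this]
  apply Finset.sum_congr rfl
  intro j hj
  rw [Finset.mem_Ico] at hj
  rw [Nat.choose_symm (by omega)]

lemma tail_mid (n d : ℕ) (hd : n / 2 + d ≤ n) :
    (2:ℝ) ^ n ≤ 2 * tailS n d + (2 * d + 1) * n.choose (n / 2) := by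
  have h1 := tail_compl n d hd
  have h2 := tail_refl n d hd
  rw [Finset.range_eq_Ico, ← Finset.sum_Ico_consecutive _ (Nat.zero_le (n - n/2 - d)) (by omega),
    ← Finset.range_eq_Ico, ← h2] at h1
  have h3 : ∑ j ∈ Finset.Ico (n - n / 2 - d) (n / 2 + d + 1), (n.choose j : ℝ)
      ≤ (2 * d + 1) * n.choose (n / 2) := by
    calc _ ≤ ∑ j ∈ Finset.Ico (n - n / 2 - d) (n / 2 + d + 1), (n.choose (n / 2) : ℝ) :=
          Finset.sum_le_sum fun j _ => by exact_mod_cast Nat.choose_le_middle j n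
      _ = ((n / 2 + d + 1 - (n - n / 2 - d) : ℕ) : ℝ) * n.choose (n / 2) := by simp
      _ ≤ _ := by
        apply mul_le_mul_of_nonneg_right _ (by positivity)
        have : n / 2 + d + 1 - (n - n / 2 - d) ≤ 2 * d + 1 := by omega
        exact_mod_cast this
  linarith

lemma middle_real (n : ℕ) : (n.choose (n / 2) : ℝ) * Real.sqrt n ≤ 2 ^ n := by
  have h : ((n.choose (n / 2) : ℝ)) ^ 2 * n ≤ 4 ^ n := by exact_mod_cast middle_sq n
  apply le_of_sq_le_sq _ (by positivity)
  rw [mul_pow, Real.sq_sqrt (by positivity), ← pow_mul, mul_comm n 2, pow_mul]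
  norm_num
  exact h

lemma tail_small (n d : ℕ) (hn : 4 ≤ n) (hd1 : 1 ≤ d) (hd : 9 * (d:ℝ) < Real.sqrt n) :
    (2:ℝ) ^ n / 3 < tailS n d := by
  have hs : Real.sqrt n ^ 2 = n := Real.sq_sqrt (by positivity)
  have hd1' : (1:ℝ) ≤ d := by exact_mod_cast hd1
  have hle : n / 2 + d ≤ n := by
    have : 2 * (d:ℝ) ≤ n := by nlinarith
    have : 2 * d ≤ n := by exact_mod_cast this
    omega
  have h1 := tail_mid n d hle
  have h2 := middle_real n
  have h3 : (0:ℝ) < n.choose (n / 2) := by exact_mod_cast Nat.choose_pos (by omega)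
  nlinarith

lemma tail_half (n : ℕ) (hn : 4 ≤ n) : (2:ℝ) ^ n / 4 ≤ tailS n 0 := by
  have h1 := tail_mid n 0 (by omega)
  have h2 := middle_real n
  have h3 : (0:ℝ) ≤ n.choose (n / 2) := by positivity
  have h4 : (2:ℝ) ≤ Real.sqrt n := by
    apply Real.le_sqrt_of_sq_le
    norm_num
    exact_mod_cast hn
  push_cast at h1
  nlinarith

lemma choose_step (n d j : ℕ) (hd : 4 * d ≤ n) (hj : j + 1 ≤ n / 2 + 2 * d) (hn : 0 < n) :
    (1 - 8 * (d:ℝ) / n) * n.choose j ≤ n.choose (j + 1) := by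
  have h := Nat.choose_succ_right_eq n j
  have hjn : j ≤ n := by omega
  have h' : (n.choose (j+1) : ℝ) * (j + 1) = n.choose j * (n - j) := by
    rw [← Nat.cast_sub hjn]; exact_mod_cast h
  have hj' : (j:ℝ) + 1 ≤ n / 2 + 2 * d := by
    have : 2 * (j + 1) ≤ n + 4 * d := by omega
    have : 2 * ((j:ℝ) + 1) ≤ n + 4 * d := by exact_mod_cast this
    linarith
  have hn' : (0:ℝ) < n := by exact_mod_cast hn
  have hj0 : (0:ℝ) ≤ j := by positivity
  have hd0 : (0:ℝ) ≤ d := by positivity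
  have hc : (0:ℝ) ≤ n.choose j := by positivity
  have key : (1 - 8 * (d:ℝ) / n) * (j + 1) ≤ n - j := by
    by_cases hx : 1 - 8 * (d:ℝ) / n ≤ 0
    · have : (j:ℝ) ≤ n := by exact_mod_cast hjn
      nlinarith
    · push Not at hx
      calc (1 - 8 * (d:ℝ) / n) * (j + 1) ≤ (1 - 8 * (d:ℝ) / n) * (n / 2 + 2 * d) :=
            mul_le_mul_of_nonneg_left hj' hx.le
        _ = n / 2 - 2 * d - 16 * d ^ 2 / n := by field_simp; ring
        _ ≤ n / 2 - 2 * d := by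
            have : 0 ≤ 16 * (d:ℝ) ^ 2 / n := by positivity
            linarith
        _ ≤ n - j := by linarith
  have hj1 : (0:ℝ) < j + 1 := by linarith
  apply le_of_mul_le_mul_right _ hj1
  rw [h']
  nlinarith

lemma choose_steps (n d j s : ℕ) (hd : 8 * d ≤ n) (hj : j + s ≤ n / 2 + 2 * d) (hn : 0 < n) :
    (1 - 8 * (d:ℝ) / n) ^ s * n.choose j ≤ n.choose (j + s) := by
  induction s with
  | zero => simp
  | succ s ih =>
    have h1 := ih (by omega)
    have h2 := choose_step n d (j + s) (by omega) (by omega) hn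
    have h3 : 0 ≤ 1 - 8 * (d:ℝ) / n := by
      rw [sub_nonneg, div_le_one (by exact_mod_cast hn)]
      exact_mod_cast hd
    calc _ = (1 - 8 * (d:ℝ) / n) * ((1 - 8 * (d:ℝ) / n) ^ s * n.choose j) := by ring
      _ ≤ (1 - 8 * (d:ℝ) / n) * n.choose (j + s) := mul_le_mul_of_nonneg_left h1 h3
      _ ≤ _ := h2

lemma tail_large (n d : ℕ) (hn : 4 ≤ n) (hd : 8 * d ≤ n) :
    (1 - 8 * (d:ℝ) / n) ^ d * (2 ^ n / 8) ≤ tailS n d := by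
  set ρ := (1 - 8 * (d:ℝ) / n) ^ d with hρ
  have h3 : 0 ≤ 1 - 8 * (d:ℝ) / n := by
    rw [sub_nonneg, div_le_one (by exact_mod_cast (by omega : 0 < n))]
    exact_mod_cast hd
  have h0 : 0 ≤ ρ := pow_nonneg h3 _
  have h1 : ρ ≤ 1 := pow_le_one₀ h3 (by
    have : 0 ≤ 8 * (d:ℝ) / n := by positivity
    linarith)
  have hH := tail_half n hn
  have hT0 : 0 ≤ tailS n d := Finset.sum_nonneg fun _ _ => by positivity
  have hsplit : tailS n 0 = (∑ j ∈ Finset.Ico (n / 2 + 1) (n / 2 + d + 1), (n.choose j : ℝ))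
      + tailS n d := by
    unfold tailS
    rw [Finset.sum_Ico_consecutive _ (by omega) (by omega)]
  have hshift : ρ * (∑ j ∈ Finset.Ico (n / 2 + 1) (n / 2 + d + 1), (n.choose j : ℝ)) ≤ tailS n d := by
    rw [Finset.mul_sum]
    calc _ ≤ ∑ j ∈ Finset.Ico (n / 2 + 1) (n / 2 + d + 1), (n.choose (j + d) : ℝ) := by
          apply Finset.sum_le_sum
          intro j hj
          rw [Finset.mem_Ico] at hj
          exact choose_steps n d j d hd (by omega) (by omega)
      _ = ∑ j ∈ Finset.Ico (n / 2 + 1 + d) (n / 2 + d + 1 + d), (n.choose j : ℝ) :=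
          Finset.sum_Ico_add' (fun j => (n.choose j : ℝ)) _ _ d
      _ ≤ tailS n d := by
          unfold tailS
          apply Finset.sum_le_sum_of_subset_of_nonneg
          · apply Finset.Ico_subset_Ico <;> omega
          · intros; positivity
  nlinarith

lemma one_sub_ge (x : ℝ) (h0 : 0 ≤ x) (h1 : x ≤ 1 / 2) : (2:ℝ) ^ (-(2 * x)) ≤ 1 - x := by
  have hconv : ConvexOn ℝ Set.univ (fun t : ℝ => Real.exp t) := convexOn_exp
  have h := hconv.2 (Set.mem_univ 0) (Set.mem_univ (-Real.log 2))
    (show 0 ≤ 1 - 2 * x by linarith) (show 0 ≤ 2 * x by linarith) (by ring)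
  simp only [smul_eq_mul, mul_zero, zero_add, Real.exp_zero, Real.exp_neg,
    Real.exp_log (by norm_num : (0:ℝ) < 2)] at h
  rw [Real.rpow_def_of_pos (by norm_num)]
  rw [show Real.log 2 * -(2 * x) = 2 * x * -Real.log 2 by ring]
  linarith

/-- The analytic part: if the tail is at most `δ 2^n` then `d` is large. -/
lemma analytic_part (n d : ℕ) (hn : 4 ≤ n) (hd1 : 1 ≤ d) (δ : ℝ) (hδ0 : 1 / 2 ^ n ≤ δ)
    (hδ : δ < 1 / 3)
    (htail : (2:ℝ) ^ n - δ * 2 ^ n ≤ ∑ j ∈ Finset.range (n / 2 + d + 1), (n.choose j : ℝ)) :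
    1 / 20 * Real.sqrt (n * Real.logb 2 (1 / δ)) ≤ d := by
  by_contra hcon
  push Not at hcon
  set L := Real.logb 2 (1 / δ) with hL
  have h2n : (0:ℝ) < 2 ^ n := by positivity
  have hδp : 0 < δ := lt_of_lt_of_le (by positivity) hδ0
  have hδL : δ = 2 ^ (-L) := by
    rw [Real.rpow_neg (by norm_num), hL, Real.rpow_logb (by norm_num) (by norm_num) (by positivity)]
    simp
  have hLn : L ≤ n := by
    rw [hL, Real.logb_le_iff_le_rpow (by norm_num) (by positivity), Real.rpow_natCast]
    rw [div_le_iff₀ hδp]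
    rw [div_le_iff₀ h2n] at hδ0
    linarith
  have hL0 : 0 ≤ L := Real.logb_nonneg (by norm_num) (by rw [le_div_iff₀ hδp]; linarith)
  have hn' : (0:ℝ) < n := by exact_mod_cast (by omega : 0 < n)
  have hd0 : (1:ℝ) ≤ d := by exact_mod_cast hd1
  have hsq : 400 * (d:ℝ) ^ 2 < n * L := by
    have h := Real.sq_sqrt (show 0 ≤ n * L by positivity)
    have h' : 20 * (d:ℝ) < Real.sqrt (n * L) := by linarith
    nlinarith
  have hdn : 20 * (d:ℝ) ≤ n := by
    apply le_of_sq_le_sq _ hn'.le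
    nlinarith
  have hdn' : 20 * d ≤ n := by exact_mod_cast hdn
  have hc := tail_compl n d (by omega)
  have hT : tailS n d ≤ δ * 2 ^ n := by linarith
  by_cases hsmall : 9 * (d:ℝ) < Real.sqrt n
  · have := tail_small n d hn hd1 hsmall
    nlinarith
  · push Not at hsmall
    have hs2 : (n:ℝ) ≤ 81 * (d:ℝ) ^ 2 := by
      have h := Real.sq_sqrt hn'.le
      have := Real.sqrt_nonneg (n:ℝ)
      nlinarith
    have hl := tail_large n d hn (by omega)
    have hx := one_sub_ge (8 * (d:ℝ) / n) (by positivity) (by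
      rw [div_le_iff₀ hn']; linarith)
    have hpow : ((2:ℝ) ^ (-(2 * (8 * (d:ℝ) / n)))) ^ d ≤ (1 - 8 * (d:ℝ) / n) ^ d :=
      pow_le_pow_left₀ (by positivity) hx d
    rw [← Real.rpow_natCast, ← Real.rpow_mul (by norm_num)] at hpow
    have h8 : (2:ℝ) ^ (-(2 * (8 * (d:ℝ) / n)) * d) / 8 ≤ δ := by
      have : (2:ℝ) ^ (-(2 * (8 * (d:ℝ) / n)) * d) / 8 * 2 ^ n ≤ δ * 2 ^ n := by
        have h9 := mul_le_mul_of_nonneg_right hpow (by positivity : (0:ℝ) ≤ 2 ^ n / 8)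
        linarith
      exact le_of_mul_le_mul_right this h2n
    have h10 : (2:ℝ) ^ (-(2 * (8 * (d:ℝ) / n)) * d) / 8
        = 2 ^ (-(2 * (8 * (d:ℝ) / n)) * d - 3) := by
      rw [Real.rpow_sub (by norm_num)]
      norm_num
    rw [h10, hδL] at h8
    have h11 := (Real.rpow_le_rpow_left_iff (by norm_num : (1:ℝ) < 2)).1 h8
    have h12 : (n:ℝ) * L ≤ 16 * (d:ℝ) ^ 2 + 3 * n := by
      have h13 : L ≤ 2 * (8 * (d:ℝ) / n) * d + 3 := by linarith
      calc (n:ℝ) * L ≤ n * (2 * (8 * (d:ℝ) / n) * d + 3) := mul_le_mul_of_nonneg_left h13 hn'.le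
        _ = _ := by field_simp; ring
    nlinarith

/-- Smolensky's lower bound for MOD functions: some residue class
`i` modulo `b` has large probabilistic degree. -/
theorem stmt8 :
    ∃ c : ℝ, 0 < c ∧
      ∀ (n b : ℕ), 4 ≤ n → 2 ≤ b → 2 * b ≤ n →
        ∀ (F : Type) [Field F] (p : ℕ) [CharP F p],
          (p = 0 ∨ (p.Prime ∧ ¬ p ∣ b)) →
          ∀ ε : ℝ, 1 / (2:ℝ)^n < ε → ε < 1 / (3 * (b:ℝ)) →
            ∃ i < b,
              c * Real.sqrt (n * Real.logb 2 (1 / ((b:ℝ) * ε)))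
                ≤ (pdeg F (fun a : Fin n → Bool => decide (wt a % b = i)) ε : ℝ) := by
  refine ⟨1 / 20, by norm_num, ?_⟩
  intro n b hn hb hbn F _ p _ hp ε hε1 hε2
  by_contra hcon
  push Not at hcon
  have hε : 0 < ε := lt_trans (by positivity) hε1
  have hbR : (2:ℝ) ≤ b := by exact_mod_cast hb
  have hbε : (b:ℝ) * ε < 1 / 3 := by
    rw [lt_div_iff₀ (by positivity)] at hε2
    linarith
  have hbF : (b : F) ≠ 0 := by
    intro h0
    rw [CharP.cast_eq_zero_iff F p b] at h0
    rcases hp with rfl | ⟨_, hp⟩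
    · rw [zero_dvd_iff] at h0
      omega
    · exact hp h0
  obtain ⟨i₀, hi₀, hmax⟩ := Finset.exists_max_image (Finset.range b)
    (fun i => pdeg F (fun a : Fin n → Bool => decide (wt a % b = i)) ε)
    ⟨0, Finset.mem_range.2 (by omega)⟩
  rw [Finset.mem_range] at hi₀
  set d := pdeg F (fun a : Fin n → Bool => decide (wt a % b = i₀)) ε with hd
  have hpos : 1 ≤ d := by
    refine le_trans ?_ (hmax 0 (Finset.mem_range.2 (by omega)))
    apply pdeg_pos F _ hε.le (by nlinarith) (fun _ => false) (fun j => decide (j = ⟨0, by omega⟩))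
    have h1 : wt (fun _ : Fin n => false) = 0 := by simp [wt]
    have h2 : wt (fun j : Fin n => decide (j = ⟨0, by omega⟩)) = 1 := by
      simp [wt, Finset.filter_eq']
    simp only [h1, h2, Nat.mod_eq_of_lt (by omega : 1 < b)]
    simp
  have halg := algebraic_part hb F hbF hε.le (d := d)
    (fun i hi => hmax i (Finset.mem_range.2 hi))
  have := analytic_part n d hn hpos (b * ε) (by nlinarith) hbε halg
  exact absurd this (not_le.2 (hcon i₀ hi₀))
end
end

section
/- There is an absolute constant C > 0 such that for every field F, every n ≥ 1, every ε ∈ (0, 1/3], and every symmetric Boolean function f : {0,1}^n → {0,1}, pdeg^F_ε(f) ≤ C·√(n·log(1/ε)). -/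
noncomputable section

open scoped BigOperators

namespace SymPoly

/-- Newton interpolation with binomial coefficients, valid over any field. -/
lemma newton {F : Type} [Field F] (d : ℕ) : ∀ (c : ℕ) (h : ℕ → F), ∃ α : ℕ → F,
    ∀ t, c ≤ t → t ≤ c + d → ∑ j ∈ Finset.range (d + 1), α j * (Nat.choose t j : F) = h t := by
  induction d with
  | zero =>
    intro c h
    refine ⟨fun _ => h c, fun t h1 h2 => ?_⟩
    have : t = c := by omega
    subst this
    simp
  | succ d ih =>
    intro c h
    obtain ⟨α, hα⟩ := ih c (fun t => h (t + 1) - h t)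
    let S : ℕ → F := fun t => ∑ j ∈ Finset.range (d + 1), α j * (Nat.choose t (j + 1) : F)
    refine ⟨fun j => Nat.casesOn j (h c - S c) α, fun t h1 h2 => ?_⟩
    rw [Finset.sum_range_succ']
    simp only [Nat.choose_zero_right, Nat.cast_one, mul_one]
    change S t + (h c - S c) = h t
    obtain ⟨e, rfl⟩ := Nat.exists_eq_add_of_le h1
    induction e with
    | zero => simp
    | succ e ihe =>
      have h3 := ihe (by omega) (by omega)
      have h4 := hα (c + e) (by omega) (by omega)
      have h5 : S (c + (e + 1)) = S (c + e) + (h (c + e + 1) - h (c + e)) := by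
        rw [← h4]
        simp only [S]
        rw [← Finset.sum_add_distrib]
        refine Finset.sum_congr rfl fun j _ => ?_
        rw [← add_assoc, Nat.choose_succ_succ]
        push_cast
        ring
      rw [h5, ← add_assoc c e 1]
      linear_combination h3

/-- The variable with index `j`, or `0` when `j` is out of range. -/
def y (F : Type) [Field F] (n : ℕ) (j : ℕ) : MvPolynomial (Fin n) F :=
  if h : j < n then MvPolynomial.X ⟨j, h⟩ else 0

/-- The value of the `j`-th padded input bit. -/
def b {n : ℕ} (a : Fin n → Bool) (j : ℕ) : ℕ :=
  if h : j < n then (a ⟨j, h⟩).toNat else 0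

lemma y_deg (F : Type) [Field F] (n j : ℕ) : (y F n j).totalDegree ≤ 1 := by
  unfold y
  split_ifs
  · simp
  · simp

lemma y_eval (F : Type) [Field F] {n : ℕ} (a : Fin n → Bool) (j : ℕ) :
    MvPolynomial.eval (fun v => bF F (a v)) (y F n j) = (b a j : F) := by
  unfold y b
  split_ifs with h
  · cases h' : a ⟨j, h⟩ <;> simp [bF, h']
  · simp

lemma b_le {n : ℕ} (a : Fin n → Bool) (j : ℕ) : b a j = 0 ∨ b a j = 1 := by
  unfold b
  split_ifs with h
  · cases h' : a ⟨j, h⟩ <;> simp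
  · simp

/-- Weight of a selection of `m` padded input bits. -/
def W {n : ℕ} (a : Fin n → Bool) (u : ℕ → ℕ) (m : ℕ) : ℕ := ∑ i ∈ Finset.range m, b a (u i)

lemma elem (F : Type) [Field F] (n : ℕ) (u : ℕ → ℕ) (m : ℕ) : ∀ j : ℕ,
    ∃ E : MvPolynomial (Fin n) F, E.totalDegree ≤ j ∧ ∀ a : Fin n → Bool,
      MvPolynomial.eval (fun v => bF F (a v)) E = (Nat.choose (W a u m) j : F) := by
  induction m with
  | zero =>
    intro j
    cases j with
    | zero => exact ⟨1, by simp, fun a => by simp⟩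
    | succ j => exact ⟨0, by simp, fun a => by simp [W]⟩
  | succ m ih =>
    intro j
    cases j with
    | zero => exact ⟨1, by simp, fun a => by simp⟩
    | succ j =>
      obtain ⟨E1, d1, e1⟩ := ih (j + 1)
      obtain ⟨E0, d0, e0⟩ := ih j
      refine ⟨E1 + E0 * y F n (u m), ?_, fun a => ?_⟩
      · refine (MvPolynomial.totalDegree_add _ _).trans (max_le d1 ?_)
        exact (MvPolynomial.totalDegree_mul _ _).trans (add_le_add d0 (y_deg F n _))
      · rw [map_add, map_mul, e1, e0, y_eval]
        have : W a u (m + 1) = W a u m + b a (u m) := by simp [W, Finset.sum_range_succ]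
        rw [this]
        rcases b_le a (u m) with h | h <;> rw [h]
        · simp
        · rw [Nat.choose_succ_succ]
          push_cast
          ring

lemma interp (F : Type) [Field F] (n : ℕ) (u : ℕ → ℕ) (m c d : ℕ) (h : ℕ → F) :
    ∃ A : MvPolynomial (Fin n) F, A.totalDegree ≤ d ∧ ∀ a : Fin n → Bool,
      c ≤ W a u m → W a u m ≤ c + d →
      MvPolynomial.eval (fun v => bF F (a v)) A = h (W a u m) := by
  obtain ⟨α, hα⟩ := newton d c h
  choose E dE eE using elem F n u m
  refine ⟨∑ j ∈ Finset.range (d + 1), MvPolynomial.C (α j) * E j, ?_, fun a h1 h2 => ?_⟩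
  · refine MvPolynomial.totalDegree_finsetSum_le fun j hj => ?_
    refine (MvPolynomial.totalDegree_mul _ _).trans ?_
    have := dE j
    have := Finset.mem_range.1 hj
    simp only [MvPolynomial.totalDegree_C]
    omega
  · rw [map_sum, ← hα _ h1 h2]
    refine Finset.sum_congr rfl fun j _ => ?_
    rw [map_mul, MvPolynomial.eval_C, eE]

/-- Signs. -/
def sg (s : Bool) : ℝ := if s then 1 else -1

lemma mgf (m : ℕ) (d : Fin m → ℝ) (hd : ∀ i, |d i| ≤ 1) (l : ℝ) :
    ∑ s : Fin m → Bool, Real.exp (l * ∑ i, sg (s i) * d i) ≤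
      2 ^ m * Real.exp (m * l ^ 2 / 2) := by
  have h1 : ∑ s : Fin m → Bool, Real.exp (l * ∑ i, sg (s i) * d i) =
      ∏ i, ∑ t : Bool, Real.exp (l * (sg t * d i)) := by
    rw [Finset.prod_univ_sum]
    simp only [Fintype.piFinset_univ]
    refine Finset.sum_congr rfl fun s _ => ?_
    rw [Finset.mul_sum, Real.exp_sum]
  rw [h1]
  have h2 : ∀ i, ∑ t : Bool, Real.exp (l * (sg t * d i)) ≤ 2 * Real.exp (l ^ 2 / 2) := by
    intro i
    have h3 : ∑ t : Bool, Real.exp (l * (sg t * d i)) = 2 * Real.cosh (l * d i) := by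
      rw [Real.cosh_eq]
      simp [sg]
      ring
    rw [h3]
    have h4 := Real.cosh_le_exp_half_sq (l * d i)
    have h5 : (l * d i) ^ 2 / 2 ≤ l ^ 2 / 2 := by
      have : (d i) ^ 2 ≤ 1 := by
        rw [← sq_abs]
        have := hd i
        have := abs_nonneg (d i)
        nlinarith
      rw [mul_pow]
      nlinarith [sq_nonneg l]
    have := Real.exp_le_exp.2 h5
    linarith
  refine (Finset.prod_le_prod (fun i _ => Finset.sum_nonneg fun t _ => (Real.exp_pos _).le)
    (fun i _ => h2 i)).trans ?_
  rw [Finset.prod_const, Finset.card_univ, Fintype.card_fin, mul_pow, ← Real.exp_nat_mul]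
  apply le_of_eq
  congr 2
  ring

lemma tail1 (m : ℕ) (hm : 0 < m) (d : Fin m → ℝ) (hd : ∀ i, |d i| ≤ 1) (t : ℝ) (ht : 0 ≤ t) :
    ((Finset.univ.filter fun s : Fin m → Bool => t ≤ ∑ i, sg (s i) * d i).card : ℝ) ≤
      2 ^ m * Real.exp (-(t ^ 2 / (2 * m))) := by
  have hm' : (0 : ℝ) < m := by exact_mod_cast hm
  have h1 := mgf m d hd (t / m)
  have h2 : ((Finset.univ.filter fun s : Fin m → Bool => t ≤ ∑ i, sg (s i) * d i).card : ℝ) *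
      Real.exp (t / m * t) ≤ ∑ s : Fin m → Bool, Real.exp (t / m * ∑ i, sg (s i) * d i) := by
    have hA : (Finset.univ.filter fun s : Fin m → Bool => t ≤ ∑ i, sg (s i) * d i).card •
        Real.exp (t / m * t) ≤
        ∑ s ∈ Finset.univ.filter (fun s : Fin m → Bool => t ≤ ∑ i, sg (s i) * d i),
          Real.exp (t / m * ∑ i, sg (s i) * d i) := by
      apply Finset.card_nsmul_le_sum
      intro s hs
      have := (Finset.mem_filter.1 hs).2
      apply Real.exp_le_exp.2
      exact mul_le_mul_of_nonneg_left this (by positivity)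
    rw [nsmul_eq_mul] at hA
    exact hA.trans (Finset.sum_le_sum_of_subset_of_nonneg (Finset.filter_subset _ _)
      fun _ _ _ => (Real.exp_pos _).le)
  have h3 := h2.trans h1
  rw [← le_div_iff₀ (Real.exp_pos _), mul_div_assoc, ← Real.exp_sub] at h3
  refine h3.trans (le_of_eq ?_)
  congr 2
  field_simp
  ring

lemma tail2 (m : ℕ) (hm : 0 < m) (d : Fin m → ℝ) (hd : ∀ i, |d i| ≤ 1) (t : ℝ) (ht : 0 ≤ t) :
    ((Finset.univ.filter fun s : Fin m → Bool => t ≤ |∑ i, sg (s i) * d i|).card : ℝ) ≤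
      2 * (2 ^ m * Real.exp (-(t ^ 2 / (2 * m)))) := by
  have h1 := tail1 m hm d hd t ht
  have h2 := tail1 m hm (fun i => - d i) (fun i => by simpa using hd i) t ht
  have h3 : (Finset.univ.filter fun s : Fin m → Bool => t ≤ |∑ i, sg (s i) * d i|) ⊆
      (Finset.univ.filter fun s : Fin m → Bool => t ≤ ∑ i, sg (s i) * d i) ∪
      (Finset.univ.filter fun s : Fin m → Bool => t ≤ ∑ i, sg (s i) * (- d i)) := by
    intro s hs
    simp only [Finset.mem_union, Finset.mem_filter, Finset.mem_univ, true_and] at hs ⊢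
    simpa [le_abs] using hs
  have h4 := (Finset.card_le_card h3).trans (Finset.card_union_le _ _)
  have h5 : ((Finset.univ.filter fun s : Fin m → Bool => t ≤ |∑ i, sg (s i) * d i|).card : ℝ) ≤
      ((Finset.univ.filter fun s : Fin m → Bool => t ≤ ∑ i, sg (s i) * d i).card : ℝ) +
      ((Finset.univ.filter fun s : Fin m → Bool => t ≤ ∑ i, sg (s i) * (- d i)).card : ℝ) := by
    exact_mod_cast h4
  linarith

/-- Select one bit of each pair. -/
def pick (u : ℕ → ℕ) (m : ℕ) (s : Fin m → Bool) (i : ℕ) : ℕ :=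
  if h : i < m then u (2 * i + (s ⟨i, h⟩).toNat) else 0

lemma W_double {n : ℕ} (a : Fin n → Bool) (u : ℕ → ℕ) (m : ℕ) :
    W a u (2 * m) = ∑ i ∈ Finset.range m, (b a (u (2 * i)) + b a (u (2 * i + 1))) := by
  unfold W
  induction m with
  | zero => simp
  | succ m ih =>
    rw [Finset.sum_range_succ, ← ih, show 2 * (m + 1) = 2 * m + 1 + 1 by ring,
      Finset.sum_range_succ, Finset.sum_range_succ]
    ring

/-- Difference of a pair of bits. -/
def df {n : ℕ} (a : Fin n → Bool) (u : ℕ → ℕ) (i : ℕ) : ℝ :=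
  (b a (u (2 * i + 1)) : ℝ) - (b a (u (2 * i)) : ℝ)

lemma df_le {n : ℕ} (a : Fin n → Bool) (u : ℕ → ℕ) (i : ℕ) : |df a u i| ≤ 1 := by
  unfold df
  rcases b_le a (u (2 * i + 1)) with h | h <;> rcases b_le a (u (2 * i)) with h' | h' <;>
    rw [h, h'] <;> simp

lemma pick_diff {n : ℕ} (a : Fin n → Bool) (u : ℕ → ℕ) (m : ℕ) (s : Fin m → Bool) :
    2 * (W a (pick u m s) m : ℝ) - (W a u (2 * m) : ℝ) =
      ∑ i : Fin m, sg (s i) * df a u (i : ℕ) := by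
  rw [W_double]
  unfold W
  rw [Finset.sum_range, Finset.sum_range]
  push_cast
  rw [Finset.mul_sum, ← Finset.sum_sub_distrib]
  refine Finset.sum_congr rfl fun i _ => ?_
  cases h : s i <;> simp [pick, h, sg, df] <;> ring

lemma W_le {n : ℕ} (a : Fin n → Bool) (u : ℕ → ℕ) (m : ℕ) : W a u m ≤ m := by
  unfold W
  calc _ ≤ ∑ i ∈ Finset.range m, 1 := Finset.sum_le_sum fun i _ => by
        rcases b_le a (u i) with h | h <;> omega
    _ = m := by simp

/-- The tuple `P` of polynomials is the indicator vector of the weight at `a`. -/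
def Good {F : Type} [Field F] {n : ℕ} (P : ℕ → MvPolynomial (Fin n) F) (a : Fin n → Bool)
    (w : ℕ) : Prop :=
  ∀ v, MvPolynomial.eval (fun v => bF F (a v)) (P v) = if v = w then 1 else 0

open Classical in
/-- One sampling step. -/
lemma step (F : Type) [Field F] (n m : ℕ) (hm : 0 < m) (u : ℕ → ℕ) (t δ D : ℝ) (ht : 0 ≤ t)
    (hδ : 2 * Real.exp (-(t ^ 2 / (2 * m))) ≤ δ)
    (Ω : Type) [Fintype Ω]
    (H : ∀ u : ℕ → ℕ, ∃ P : Ω → ℕ → MvPolynomial (Fin n) F,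
      (∀ ω v, ((P ω v).totalDegree : ℝ) ≤ D) ∧ ∀ a : Fin n → Bool,
        ((Finset.univ.filter fun ω => ¬ Good (P ω) a (W a u m)).card : ℝ) ≤
          δ * Fintype.card Ω) :
    ∃ P : (Fin m → Bool) × Ω → ℕ → MvPolynomial (Fin n) F,
      (∀ ω v, ((P ω v).totalDegree : ℝ) ≤ D + 2 * t) ∧ ∀ a : Fin n → Bool,
        ((Finset.univ.filter fun ω => ¬ Good (P ω) a (W a u (2 * m))).card : ℝ) ≤
          (2 * δ) * Fintype.card ((Fin m → Bool) × Ω) := by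
  choose P hPd hPe using H
  have hT : ((⌊t⌋₊ : ℕ) : ℝ) ≤ t := Nat.floor_le ht
  set T := ⌊t⌋₊ with hTdef
  choose A hAd hAe using fun (x v : ℕ) => interp F n u (2 * m) (2 * x - T) (2 * T)
    (fun w => if v = w then (1 : F) else 0)
  refine ⟨fun ω v => ∑ x ∈ Finset.range (m + 1), P (pick u m ω.1) ω.2 x * A x v, ?_, ?_⟩
  · rintro ⟨s, ω⟩ v
    have h1 : ∀ x v, (P (pick u m s) ω x * A x v).totalDegree ≤ ⌊D⌋₊ + 2 * T := by
      intro x v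
      refine (MvPolynomial.totalDegree_mul _ _).trans (add_le_add ?_ (hAd x v))
      exact Nat.le_floor (hPd _ ω x)
    have h2 : (∑ x ∈ Finset.range (m + 1), P (pick u m s) ω x * A x v).totalDegree ≤
        ⌊D⌋₊ + 2 * T := MvPolynomial.totalDegree_finsetSum_le fun x _ => h1 x v
    have hD : 0 ≤ D := le_trans (by positivity) (hPd (pick u m s) ω 0)
    have h3 : ((⌊D⌋₊ : ℕ) : ℝ) ≤ D := Nat.floor_le hD
    have h4 : ((∑ x ∈ Finset.range (m + 1), P (pick u m s) ω x * A x v).totalDegree : ℝ) ≤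
      (⌊D⌋₊ : ℝ) + 2 * (T : ℝ) := by exact_mod_cast h2
    simp only
    linarith
  · intro a
    set B1 := Finset.univ.filter fun s : Fin m → Bool =>
      t ≤ |∑ i : Fin m, sg (s i) * df a u (i : ℕ)| with hB1
    have hb1 := tail2 m hm (fun i => df a u (i : ℕ)) (fun i => df_le a u i) t ht
    have key : ∀ s ω, s ∉ B1 → Good (P (pick u m s) ω) a (W a (pick u m s) m) →
        Good (fun v => ∑ x ∈ Finset.range (m + 1), P (pick u m s) ω x * A x v) a
          (W a u (2 * m)) := by
      intro s ω hs hg v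
      have hs' : |2 * (W a (pick u m s) m : ℝ) - (W a u (2 * m) : ℝ)| < t := by
        rw [pick_diff]
        simpa [hB1] using hs
      rw [map_sum, Finset.sum_eq_single (W a (pick u m s) m)]
      · rw [map_mul, hg, if_pos rfl, one_mul]
        have h5 : |2 * (W a (pick u m s) m : ℤ) - (W a u (2 * m) : ℤ)| ≤ (T : ℤ) := by
          have : (|2 * (W a (pick u m s) m : ℤ) - (W a u (2 * m) : ℤ)|).toNat ≤ T := by
            apply Nat.le_floor
            have h6 : (((|2 * (W a (pick u m s) m : ℤ) - (W a u (2 * m) : ℤ)|).toNat : ℤ) : ℝ)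
                = |2 * (W a (pick u m s) m : ℝ) - (W a u (2 * m) : ℝ)| := by
              rw [Int.toNat_of_nonneg (abs_nonneg _)]
              push_cast
              rfl
            rw [Int.cast_natCast] at h6
            rw [h6]
            exact hs'.le
          omega
        rw [abs_le] at h5
        exact hAe _ v a (by omega) (by omega)
      · intro x _ hx
        rw [map_mul, hg, if_neg hx, zero_mul]
      · intro hx
        exact absurd (Finset.mem_range.2 (Nat.lt_succ_of_le (W_le a _ m))) hx
    have hsub : (Finset.univ.filter fun ω : (Fin m → Bool) × Ω =>
        ¬ Good (fun v => ∑ x ∈ Finset.range (m + 1), P (pick u m ω.1) ω.2 x * A x v) a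
          (W a u (2 * m))) ⊆ (B1 ×ˢ (Finset.univ : Finset Ω)) ∪
        (Finset.univ.filter fun ω : (Fin m → Bool) × Ω =>
          ¬ Good (P (pick u m ω.1) ω.2) a (W a (pick u m ω.1) m)) := by
      rintro ⟨s, ω⟩ h
      simp only [Finset.mem_union, Finset.mem_filter, Finset.mem_univ, true_and,
        Finset.mem_product, and_true] at h ⊢
      by_contra! hc
      exact h (key s ω hc.1 hc.2)
    have hcard := (Finset.card_le_card hsub).trans (Finset.card_union_le _ _)
    rw [Finset.card_product] at hcard
    have hc2 : ((Finset.univ.filter fun ω : (Fin m → Bool) × Ω =>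
          ¬ Good (P (pick u m ω.1) ω.2) a (W a (pick u m ω.1) m)).card : ℝ) ≤
          2 ^ m * (δ * Fintype.card Ω) := by
      rw [Finset.card_filter, Fintype.sum_prod_type]
      push_cast
      calc _ ≤ ∑ s : Fin m → Bool, δ * Fintype.card Ω := by
            refine Finset.sum_le_sum fun s _ => ?_
            have := hPe (pick u m s) a
            rw [Finset.card_filter] at this
            push_cast at this
            exact this
        _ = _ := by simp
    have hcard' : ((Finset.univ.filter fun ω : (Fin m → Bool) × Ω =>
        ¬ Good (fun v => ∑ x ∈ Finset.range (m + 1), P (pick u m ω.1) ω.2 x * A x v) a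
          (W a u (2 * m))).card : ℝ) ≤ (B1.card : ℝ) * Fintype.card Ω +
          ((Finset.univ.filter fun ω : (Fin m → Bool) × Ω =>
          ¬ Good (P (pick u m ω.1) ω.2) a (W a (pick u m ω.1) m)).card : ℝ) := by
      exact_mod_cast hcard
    have hB : (B1.card : ℝ) ≤ 2 ^ m * δ := by
      refine hb1.trans ?_
      have : (0 : ℝ) < 2 ^ m := by positivity
      nlinarith
    have hB' : (B1.card : ℝ) * Fintype.card Ω ≤ 2 ^ m * δ * Fintype.card Ω :=
      mul_le_mul_of_nonneg_right hB (by positivity)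
    have hfin : (Fintype.card ((Fin m → Bool) × Ω) : ℝ) = 2 ^ m * Fintype.card Ω := by
      simp
    rw [hfin]
    linarith

lemma num_step (N ε : ℝ) (hN : 0 ≤ N) (h0 : 0 < ε) (h1 : ε ≤ 1 / 3) :
    50 * Real.sqrt (N * Real.log (1 / (ε / 2))) +
      2 * Real.sqrt (2 * N * Real.log (4 / ε)) ≤
    50 * Real.sqrt (2 * N * Real.log (1 / ε)) := by
  set L := Real.log (1 / ε) with hL
  have l2 : Real.log 2 ≤ 2 / 3 * L := by
    have h3 : Real.log 3 ≤ L := by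
      apply Real.log_le_log (by norm_num)
      rw [le_div_iff₀ h0]
      linarith
    have h4 : 3 * Real.log 2 ≤ 2 * Real.log 3 := by
      have e1 : (3 : ℝ) * Real.log 2 = Real.log (2 ^ 3) := by rw [Real.log_pow]; norm_num
      have e2 : (2 : ℝ) * Real.log 3 = Real.log (3 ^ 2) := by rw [Real.log_pow]; norm_num
      rw [e1, e2]
      exact Real.log_le_log (by norm_num) (by norm_num)
    linarith
  have hL0 : 0 ≤ L := by
    have := Real.log_pos (by norm_num : (1 : ℝ) < 2)
    linarith
  have a1 : Real.log (1 / (ε / 2)) = L + Real.log 2 := by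
    rw [hL, ← Real.log_mul (by positivity) (by norm_num)]
    congr 1
    field_simp
  have a2 : Real.log (4 / ε) = L + 2 * Real.log 2 := by
    have : 2 * Real.log 2 = Real.log (2 ^ 2) := by rw [Real.log_pow]; norm_num
    rw [this, hL, ← Real.log_mul (by positivity) (by norm_num)]
    congr 1
    field_simp
    norm_num
  rw [a1, a2]
  have b1 : Real.sqrt (N * (L + Real.log 2)) ≤ 23 / 25 * Real.sqrt (2 * N * L) := by
    rw [show (23 / 25 : ℝ) = Real.sqrt ((23 / 25) ^ 2) by
      rw [Real.sqrt_sq (by norm_num)], ← Real.sqrt_mul (by positivity)]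
    apply Real.sqrt_le_sqrt
    have : N * (L + Real.log 2) ≤ N * (5 / 3 * L) :=
      mul_le_mul_of_nonneg_left (by linarith) hN
    nlinarith [mul_nonneg hN hL0]
  have b2 : Real.sqrt (2 * N * (L + 2 * Real.log 2)) ≤ 2 * Real.sqrt (2 * N * L) := by
    rw [show (2 * Real.sqrt (2 * N * L) : ℝ) = Real.sqrt (2 ^ 2) * Real.sqrt (2 * N * L) by
      rw [Real.sqrt_sq (by norm_num)], ← Real.sqrt_mul (by positivity)]
    apply Real.sqrt_le_sqrt
    have : 2 * N * (L + 2 * Real.log 2) ≤ 2 * N * (7 / 3 * L) :=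
      mul_le_mul_of_nonneg_left (by linarith) (by positivity)
    nlinarith [mul_nonneg hN hL0]
  linarith

open Classical in
lemma main (F : Type) [Field F] (n k : ℕ) : ∀ ε : ℝ, 0 < ε → ε ≤ 1 / 3 →
    ∃ (Ω : Type) (_ : Fintype Ω), Nonempty Ω ∧
    ∀ u : ℕ → ℕ, ∃ P : Ω → ℕ → MvPolynomial (Fin n) F,
      (∀ ω v, ((P ω v).totalDegree : ℝ) ≤ 50 * Real.sqrt (2 ^ k * Real.log (1 / ε))) ∧
      ∀ a : Fin n → Bool,
        ((Finset.univ.filter fun ω => ¬ Good (P ω) a (W a u (2 ^ k))).card : ℝ) ≤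
          ε * Fintype.card Ω := by
  induction k with
  | zero =>
    intro ε h0 h1
    refine ⟨Unit, inferInstance, inferInstance, fun u => ?_⟩
    choose A hAd hAe using fun (v : ℕ) => interp F n u 1 0 1
      (fun w => if v = w then (1 : F) else 0)
    refine ⟨fun _ v => A v, fun _ v => ?_, fun a => ?_⟩
    · have h2 : ((A v).totalDegree : ℝ) ≤ 1 := by exact_mod_cast hAd v
      have h3 : (1 / 50 : ℝ) ≤ Real.sqrt (2 ^ 0 * Real.log (1 / ε)) := by
        apply Real.le_sqrt_of_sq_le
        have : 1 - (1 / ε)⁻¹ ≤ Real.log (1 / ε) := Real.one_sub_inv_le_log_of_pos (by positivity)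
        rw [one_div, inv_inv, ← one_div] at this
        norm_num at this ⊢
        linarith
      linarith
    · have : (Finset.univ.filter fun _ : Unit => ¬ Good (fun v => A v) a (W a u (2 ^ 0))) = ∅ := by
        rw [Finset.filter_eq_empty_iff]
        intro _ _
        rw [not_not]
        intro v
        have := W_le a u 1
        exact hAe v a (by omega) (by omega)
      rw [this]
      simp [h0.le]
  | succ k ih =>
    intro ε h0 h1
    obtain ⟨Ω, hΩ, hne, H⟩ := ih (ε / 2) (by positivity) (by linarith)
    refine ⟨(Fin (2 ^ k) → Bool) × Ω, inferInstance, inferInstance, fun u => ?_⟩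
    have hlog : 0 ≤ Real.log (4 / ε) := by
      apply Real.log_nonneg
      rw [le_div_iff₀ h0]
      linarith
    obtain ⟨P, hd, he⟩ := step F n (2 ^ k) (by positivity) u
      (Real.sqrt (2 * 2 ^ k * Real.log (4 / ε))) (ε / 2)
      (50 * Real.sqrt (2 ^ k * Real.log (1 / (ε / 2)))) (Real.sqrt_nonneg _) (by
        rw [Real.sq_sqrt (by positivity)]
        push_cast
        rw [show (2 * 2 ^ k * Real.log (4 / ε) / (2 * 2 ^ k) : ℝ) = Real.log (4 / ε) by
          field_simp]
        rw [Real.exp_neg, Real.exp_log (by positivity)]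
        apply le_of_eq
        field_simp
        norm_num) Ω H
    refine ⟨P, fun ω v => (hd ω v).trans ?_, fun a => ?_⟩
    · have := num_step (2 ^ k) ε (by positivity) h0 h1
      rw [pow_succ, mul_comm ((2 : ℝ) ^ k) 2]
      exact this
    · have := he a
      rw [pow_succ, mul_comm (2 ^ k) 2]
      rw [show 2 * (ε / 2) = ε by ring] at this
      convert this

lemma W_id {n : ℕ} (a : Fin n → Bool) (m : ℕ) (h : n ≤ m) : W a id m = wt a := by
  unfold W wt
  have : ∑ i ∈ Finset.range n, b a (id i) = ∑ i ∈ Finset.range m, b a (id i) := by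
    apply Finset.sum_subset (Finset.range_subset_range.2 h)
    intro x _ hx
    have : ¬ x < n := by simpa using hx
    simp [b, this]
  rw [← this, Finset.sum_range, Finset.card_filter]
  refine Finset.sum_congr rfl fun i _ => ?_
  cases h : a i <;> simp [b, h]

end SymPoly

/-- the Alman–Williams upper bound `O(√(n log(1/ε)))` for every
symmetric Boolean function over every field. -/
theorem stmt9 :
    ∃ C : ℝ, 0 < C ∧
      ∀ (F : Type) [Field F] (n : ℕ), 1 ≤ n →
        ∀ ε : ℝ, 0 < ε → ε ≤ 1/3 →
          ∀ f : (Fin n → Bool) → Bool,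
            (∀ a b : Fin n → Bool, wt a = wt b → f a = f b) →
            (pdeg F f ε : ℝ) ≤ C * Real.sqrt (n * Real.logb 2 (1/ε)) := by
  classical
  refine ⟨100, by norm_num, ?_⟩
  intro F _ n hn ε h0 h1 f hf
  obtain ⟨k, hk1, hk2⟩ : ∃ k : ℕ, n ≤ 2 ^ k ∧ 2 ^ k ≤ 2 * n := by
    refine ⟨Nat.log 2 n + 1, (Nat.lt_pow_succ_log_self (by norm_num) n).le, ?_⟩
    have := Nat.pow_log_le_self 2 (show n ≠ 0 by omega)
    rw [pow_succ]
    omega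
  obtain ⟨Ω, hΩ, hne, H⟩ := SymPoly.main F n k ε h0 h1
  obtain ⟨P, hd, he⟩ := H id
  have hg : ∃ g : ℕ → Bool, ∀ a, f a = g (wt a) := by
    refine ⟨fun w => if h : ∃ a : Fin n → Bool, wt a = w then f h.choose else false, fun a => ?_⟩
    have h : ∃ a' : Fin n → Bool, wt a' = wt a := ⟨a, rfl⟩
    simp only [h, dif_pos]
    exact hf _ _ h.choose_spec.symm
  obtain ⟨g, hg⟩ := hg
  set D : ℝ := 50 * Real.sqrt (2 ^ k * Real.log (1 / ε)) with hD
  let Q : Ω → MvPolynomial (Fin n) F := fun ω =>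
    ∑ v ∈ Finset.range (2 ^ k + 1), MvPolynomial.C (bF F (g v)) * P ω v
  have hQd : ∀ ω, (Q ω).totalDegree ≤ ⌊D⌋₊ := by
    intro ω
    refine MvPolynomial.totalDegree_finsetSum_le fun v _ => ?_
    refine (MvPolynomial.totalDegree_mul _ _).trans ?_
    rw [MvPolynomial.totalDegree_C, zero_add]
    exact Nat.le_floor (hd ω v)
  have hQe : ∀ ω a, SymPoly.Good (P ω) a (SymPoly.W a id (2 ^ k)) →
      MvPolynomial.eval (fun v => bF F (a v)) (Q ω) = bF F (f a) := by
    intro ω a hG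
    simp only [Q]
    rw [map_sum, Finset.sum_eq_single (SymPoly.W a id (2 ^ k))]
    · rw [map_mul, hG, if_pos rfl, MvPolynomial.eval_C, mul_one, SymPoly.W_id a _ hk1, hg]
    · intro x _ hx
      rw [map_mul, hG, if_neg hx, mul_zero]
    · intro hx
      exact absurd (Finset.mem_range.2 (Nat.lt_succ_of_le (SymPoly.W_le a _ _))) hx
  have hc : (0 : ℝ) < Fintype.card Ω := by exact_mod_cast Fintype.card_pos
  let e := (Fintype.equivFin Ω).symm
  let R : ProbPoly F n :=
    { k := Fintype.card Ω
      w := fun _ => 1 / (Fintype.card Ω : ℝ)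
      w_nonneg := fun _ => by positivity
      w_sum := by
        rw [Finset.sum_const, Finset.card_univ, Fintype.card_fin, nsmul_eq_mul]
        field_simp
      poly := fun i => Q (e i) }
  have hmem : pdeg F f ε ≤ ⌊D⌋₊ := by
    apply Nat.sInf_le
    refine ⟨R, fun i => hQd _, fun a => ?_⟩
    unfold errAt
    have h2 : (∑ i, if MvPolynomial.eval (fun v => bF F (a v)) (R.poly i) = bF F (f a)
        then 0 else R.w i) = ∑ ω : Ω, if MvPolynomial.eval (fun v => bF F (a v)) (Q ω) =
          bF F (f a) then 0 else 1 / (Fintype.card Ω : ℝ) :=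
      Equiv.sum_comp e (fun ω => if MvPolynomial.eval (fun v => bF F (a v)) (Q ω) =
          bF F (f a) then 0 else 1 / (Fintype.card Ω : ℝ))
    have h3 : (∑ ω : Ω, if MvPolynomial.eval (fun v => bF F (a v)) (Q ω) =
          bF F (f a) then 0 else 1 / (Fintype.card Ω : ℝ)) ≤
        ∑ ω : Ω, (if ¬ SymPoly.Good (P ω) a (SymPoly.W a id (2 ^ k)) then (1 : ℝ) else 0) *
          (1 / (Fintype.card Ω : ℝ)) := by
      refine Finset.sum_le_sum fun ω _ => ?_
      by_cases hG : SymPoly.Good (P ω) a (SymPoly.W a id (2 ^ k))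
      · rw [if_pos (hQe ω a hG)]
        simp [hG]
      · rw [if_pos hG, one_mul]
        split_ifs
        · positivity
        · exact le_rfl
    have h4 := he a
    rw [Finset.card_filter] at h4
    push_cast at h4
    rw [← Finset.sum_mul] at h3
    have h5 : (∑ ω : Ω, (if ¬ SymPoly.Good (P ω) a (SymPoly.W a id (2 ^ k)) then (1 : ℝ) else 0)) *
          (1 / (Fintype.card Ω : ℝ)) ≤ ε := by
      rw [mul_one_div, div_le_iff₀ hc]
      exact h4
    refine le_trans (le_of_eq ?_) (h3.trans h5)
    convert h2
  have hD0 : 0 ≤ D := by positivity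
  have h6 : (pdeg F f ε : ℝ) ≤ D :=
    le_trans (by exact_mod_cast hmem) (Nat.floor_le hD0)
  refine h6.trans ?_
  have hlog : 0 ≤ Real.log (1 / ε) := by
    apply Real.log_nonneg
    rw [le_div_iff₀ h0]
    linarith
  have h7 : Real.log (1 / ε) ≤ Real.logb 2 (1 / ε) := by
    unfold Real.logb
    rw [le_div_iff₀ (Real.log_pos (by norm_num))]
    have : Real.log 2 ≤ 1 := by
      have := Real.log_le_sub_one_of_pos (by norm_num : (0 : ℝ) < 2)
      linarith
    nlinarith
  have h8 : Real.sqrt (2 ^ k * Real.log (1 / ε)) ≤ 2 * Real.sqrt (n * Real.logb 2 (1 / ε)) := by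
    rw [show 2 * Real.sqrt (n * Real.logb 2 (1 / ε)) =
      Real.sqrt (2 ^ 2) * Real.sqrt (n * Real.logb 2 (1 / ε)) by
      rw [Real.sqrt_sq (by norm_num)], ← Real.sqrt_mul (by positivity)]
    apply Real.sqrt_le_sqrt
    have hk3 : (2 : ℝ) ^ k ≤ 2 * n := by exact_mod_cast hk2
    have h9 : (2 : ℝ) ^ k * Real.log (1 / ε) ≤ 2 * n * Real.logb 2 (1 / ε) :=
      mul_le_mul hk3 h7 hlog (by positivity)
    have h10 : 0 ≤ (n : ℝ) * Real.logb 2 (1 / ε) := mul_nonneg (by positivity) (hlog.trans h7)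
    linarith
  linarith
end
end

section
/- There is a constant c > 0 such that the following holds. Let F be a field of characteristic p (a prime or 0), let n ≥ 2, and let g : {0,1}^n → {0,1} be a symmetric Boolean function with 2 ≤ per(g) ≤ ⌊n/3⌋. Then for every ε ∈ [2^{−n}, 1/3]: (i) if per(g) is not a power of p, then pdeg^F_ε(g) ≥ c·√(n·log(1/ε)) / (log n)^2; (ii) if per(g) is a power of p, then pdeg^F_ε(g) ≥ c·min{ per(g), √(n·log(1/ε)) } / (log n)^2. -/
noncomputable section

open scoped BigOperators

/-- monomial function -/
def chiM (K : Type) [Field K] {m : ℕ} (T : Finset (Fin m)) : Finset (Fin m) → K :=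
  fun A => if T ⊆ A then 1 else 0

def PolyLE (K : Type) [Field K] (m d : ℕ) : Submodule K (Finset (Fin m) → K) :=
  Submodule.span K {f | ∃ T : Finset (Fin m), T.card ≤ d ∧ f = chiM K T}

lemma chiM_mem {K : Type} [Field K] {m d : ℕ} (T : Finset (Fin m)) (h : T.card ≤ d) :
    chiM K T ∈ PolyLE K m d := Submodule.subset_span ⟨T, h, rfl⟩

lemma PolyLE_mono {K : Type} [Field K] {m d e : ℕ} (h : d ≤ e) : PolyLE K m d ≤ PolyLE K m e := by
  apply Submodule.span_mono
  rintro f ⟨T, hT, rfl⟩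
  exact ⟨T, hT.trans h, rfl⟩

lemma chiM_mul {K : Type} [Field K] {m : ℕ} (T U : Finset (Fin m)) :
    chiM K T * chiM K U = chiM K (T ∪ U) := by
  ext A
  simp only [chiM, Pi.mul_apply, Finset.union_subset_iff]
  by_cases h1 : T ⊆ A <;> by_cases h2 : U ⊆ A <;> simp [h1, h2]

lemma PolyLE_mul {K : Type} [Field K] {m d e : ℕ} {f g : Finset (Fin m) → K}
    (hf : f ∈ PolyLE K m d) (hg : g ∈ PolyLE K m e) : f * g ∈ PolyLE K m (d + e) := by
  have := Submodule.mul_mem_mul hf hg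
  unfold PolyLE at this
  rw [Submodule.span_mul_span] at this
  refine Submodule.span_mono ?_ this
  rintro _ ⟨_, ⟨T, hT, rfl⟩, _, ⟨U, hU, rfl⟩, rfl⟩
  exact ⟨T ∪ U, (Finset.card_union_le _ _).trans (by omega), chiM_mul T U⟩

lemma PolyLE_one {K : Type} [Field K] {m d : ℕ} : (1 : Finset (Fin m) → K) ∈ PolyLE K m d := by
  have : (1 : Finset (Fin m) → K) = chiM K ∅ := by ext A; simp [chiM]
  rw [this]
  exact chiM_mem _ (by simp)

lemma PolyLE_prod {K : Type} [Field K] {m : ℕ} {ι : Type} (s : Finset ι)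
    (f : ι → Finset (Fin m) → K) (e : ι → ℕ) (h : ∀ i ∈ s, f i ∈ PolyLE K m (e i)) :
    ∏ i ∈ s, f i ∈ PolyLE K m (∑ i ∈ s, e i) := by
  classical
  induction s using Finset.induction_on with
  | empty => simpa using PolyLE_one
  | insert a s ha ih =>
    rw [Finset.prod_insert ha, Finset.sum_insert ha]
    exact PolyLE_mul (h _ (by simp)) (ih fun i hi => h i (by simp [hi]))

lemma PolyLE_pow {K : Type} [Field K] {m : ℕ} (f : Finset (Fin m) → K)
    (h : f ∈ PolyLE K m 1) (e : ℕ) : f ^ e ∈ PolyLE K m e := by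
  have := PolyLE_prod (Finset.range e) (fun _ => f) (fun _ => 1) (fun _ _ => h)
  simpa using this

lemma PolyLE_aeval {F K : Type} [Field F] [Field K] [Algebra F K] {m n d : ℕ}
    (P : MvPolynomial (Fin n) F) (hP : P.totalDegree ≤ d)
    (φ : Fin n → Finset (Fin m) → K) (hφ : ∀ v, φ v ∈ PolyLE K m 1) :
    (fun A => MvPolynomial.aeval (fun v => φ v A) P) ∈ PolyLE K m d := by
  have : (fun A => MvPolynomial.aeval (fun v => φ v A) P)
      = ∑ s ∈ P.support, algebraMap F K (P.coeff s) • ∏ v, φ v ^ s v := by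
    ext A
    rw [MvPolynomial.aeval_def, MvPolynomial.eval₂_eq']
    simp [Finset.sum_apply, Finset.prod_apply, Algebra.smul_def]
  rw [this]
  refine Submodule.sum_mem _ fun s hs => Submodule.smul_mem _ _ ?_
  refine PolyLE_mono ?_ (PolyLE_prod Finset.univ (fun v => φ v ^ s v) (fun v => s v)
    fun v _ => PolyLE_pow _ (hφ v) _)
  have := MvPolynomial.le_totalDegree hs
  rw [Finsupp.sum_fintype _ _ (by simp)] at this
  exact this.trans hP

lemma finrank_PolyLE {K : Type} [Field K] (m d : ℕ) :
    Module.finrank K (PolyLE K m d) ≤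
      (Finset.univ.filter fun T : Finset (Fin m) => T.card ≤ d).card := by
  classical
  have : {f | ∃ T : Finset (Fin m), T.card ≤ d ∧ f = chiM K T} =
      (((Finset.univ.filter fun T : Finset (Fin m) => T.card ≤ d).image (chiM K) :
        Finset (Finset (Fin m) → K)) : Set (Finset (Fin m) → K)) := by
    ext f
    simp [eq_comm]
  unfold PolyLE
  rw [this]
  exact (finrank_span_finset_le_card _).trans Finset.card_image_le

lemma dim_bound {K : Type} [Field K] {m D k : ℕ} (hk : D < k) (Bad : Finset (Finset (Fin m)))
    (H : ∀ f : Finset (Fin m) → K, ∃ q ∈ PolyLE K m D, ∀ A ∉ Bad, f A = q A) :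
    m.choose k ≤ Bad.card := by
  classical
  let R : (Finset (Fin m) → K) →ₗ[K] ({A // A ∉ Bad} → K) :=
    LinearMap.funLeft K K (fun A => A.1)
  have h1 : (PolyLE K m D).map R = ⊤ := by
    rw [eq_top_iff]
    intro f _
    obtain ⟨q, hq, hqf⟩ := H (fun A => if h : A ∉ Bad then f ⟨A, h⟩ else 0)
    refine ⟨q, hq, ?_⟩
    ext ⟨A, hA⟩
    have := hqf A hA
    simp only [hA, not_false_eq_true, dite_true] at this
    simp [R, LinearMap.funLeft, this]
  have h2 : Module.finrank K ({A // A ∉ Bad} → K) ≤ Module.finrank K (PolyLE K m D) := by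
    rw [← finrank_top, ← h1]
    exact Submodule.finrank_map_le _ _
  have h3 := h2.trans (finrank_PolyLE m D)
  rw [Module.finrank_fintype_fun_eq_card, Fintype.card_subtype_compl, Fintype.card_coe] at h3
  have h4 := Finset.card_filter_add_card_filter_not (s := (Finset.univ : Finset (Finset (Fin m))))
    (fun T => T.card ≤ D)
  rw [Finset.card_univ] at h4
  have h5 : m.choose k ≤ (Finset.univ.filter fun T : Finset (Fin m) => ¬ T.card ≤ D).card := by
    have : m.choose k = (Finset.powersetCard k (Finset.univ : Finset (Fin m))).card := by simp
    rw [this]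
    apply Finset.card_le_card
    intro T hT
    rw [Finset.mem_powersetCard] at hT
    simp [hT.2, hk]
  omega

/-- `ζ^{|A ∩ T|}`. -/
def yM {K : Type} [Field K] {m : ℕ} (z : K) (T : Finset (Fin m)) : Finset (Fin m) → K :=
  ∏ i ∈ T, (1 + (z - 1) • chiM K {i})

lemma chi_single {K : Type} [Field K] {m : ℕ} (i : Fin m) (A : Finset (Fin m)) :
   chiM K {i} A = if i ∈ A then 1 else 0 := by simp [chiM]

lemma yM_apply {K : Type} [Field K] {m : ℕ} (z : K) (T A : Finset (Fin m)) :
    yM z T A = ∏ i ∈ T, if i ∈ A then z else 1 := by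
  unfold yM
  rw [Finset.prod_apply]
  refine Finset.prod_congr rfl fun i _ => ?_
  simp only [Pi.add_apply, Pi.one_apply, Pi.smul_apply, chi_single]
  split_ifs <;> simp

lemma yM_mem {K : Type} [Field K] {m d : ℕ} (z : K) (T : Finset (Fin m)) (h : T.card ≤ d) :
    yM z T ∈ PolyLE K m d := by
  refine PolyLE_mono ?_ (PolyLE_prod T _ (fun _ => 1) fun i _ => ?_)
  · simpa using h
  · exact Submodule.add_mem _ PolyLE_one (Submodule.smul_mem _ _ (chiM_mem _ (by simp)))

lemma yM_span {K : Type} [Field K] {m : ℕ} (z : K) (hz : z ≠ 1) :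
    Submodule.span K (Set.range (yM (m := m) z)) = ⊤ := by
  classical
  rw [eq_top_iff]
  intro f _
  have hz' : z - 1 ≠ 0 := sub_ne_zero.2 hz
  -- delta functions
  have hd : ∀ B : Finset (Fin m), (fun A => if A = B then (1:K) else 0) ∈
      Submodule.span K (Set.range (yM (m := m) z)) := by
    intro B
    have : (fun A => if A = B then (1:K) else 0) =
        ∑ T ∈ (Finset.univ : Finset (Fin m)).powerset,
          ((∏ i ∈ T, (if i ∈ B then (z-1)⁻¹ else -(z-1)⁻¹)) *
          (∏ i ∈ Finset.univ \ T, (if i ∈ B then -(z-1)⁻¹ else 1+(z-1)⁻¹))) • yM z T := by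
      ext A
      rw [Finset.sum_apply]
      simp only [Pi.smul_apply, smul_eq_mul, yM_apply]
      have h1 : ∀ T ∈ (Finset.univ : Finset (Fin m)).powerset,
          ((∏ i ∈ T, (if i ∈ B then (z-1)⁻¹ else -(z-1)⁻¹)) *
          (∏ i ∈ Finset.univ \ T, (if i ∈ B then -(z-1)⁻¹ else 1+(z-1)⁻¹))) *
            (∏ i ∈ T, if i ∈ A then z else 1)
          = (∏ i ∈ T, ((if i ∈ B then (z-1)⁻¹ else -(z-1)⁻¹) * (if i ∈ A then z else 1))) *
          (∏ i ∈ Finset.univ \ T, (if i ∈ B then -(z-1)⁻¹ else 1+(z-1)⁻¹)) := by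
        intro T _
        rw [Finset.prod_mul_distrib]; ring
      rw [Finset.sum_congr rfl h1, ← Finset.prod_add]
      have h2 : ∀ i : Fin m, ((if i ∈ B then (z-1)⁻¹ else -(z-1)⁻¹) * (if i ∈ A then z else 1))
          + (if i ∈ B then -(z-1)⁻¹ else 1+(z-1)⁻¹) = if (i ∈ A ↔ i ∈ B) then 1 else 0 := by
        intro i
        by_cases hA : i ∈ A <;> by_cases hB : i ∈ B <;> simp [hA, hB] <;> field_simp <;> ring
      rw [Finset.prod_congr rfl (fun i _ => h2 i), Finset.prod_ite_zero]
      simp [Finset.ext_iff]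
    rw [this]
    exact Submodule.sum_mem _ fun T _ => Submodule.smul_mem _ _ (Submodule.subset_span ⟨T, rfl⟩)
  have : f = ∑ B, f B • (fun A => if A = B then (1:K) else 0) := by
    ext A
    simp [Finset.sum_apply]
  rw [this]
  exact Submodule.sum_mem _ fun T _ => Submodule.smul_mem _ _ (hd T)

lemma smolensky_s15 {K : Type} [Field K] {h d k : ℕ} (z : K) (hz : z ≠ 1) (hz0 : z ≠ 0)
    (hdk : d < k) (G : Finset (Fin (2*h)) → K) (hG : G ∈ PolyLE K (2*h) d)
    (Bad : Finset (Finset (Fin (2*h)))) (hB : ∀ A ∉ Bad, G A = z ^ A.card) :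
    (2*h).choose (h+k) ≤ Bad.card := by
  classical
  refine dim_bound (K := K) (D := h + d) (by omega) Bad ?_
  intro f
  have hf : f ∈ Submodule.span K (Set.range (yM (m := 2*h) z)) := by
    rw [yM_span z hz]; trivial
  induction hf using Submodule.span_induction with
  | mem x hx =>
    obtain ⟨T, rfl⟩ := hx
    by_cases hT : T.card ≤ h
    · exact ⟨yM z T, yM_mem z T (by omega), fun _ _ => rfl⟩
    · refine ⟨yM z⁻¹ Tᶜ * G, ?_, ?_⟩
      · refine PolyLE_mul (yM_mem _ _ ?_) hG
        rw [Finset.card_compl, Fintype.card_fin]; omega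
      · intro A hA
        rw [Pi.mul_apply, hB A hA, yM_apply, yM_apply]
        have : z ^ A.card = ∏ i, if i ∈ A then z else 1 := by
          rw [Finset.prod_ite_mem]; simp
        rw [this, ← Finset.prod_mul_prod_compl T (fun i => if i ∈ A then z else 1),
          mul_comm (∏ i ∈ T, if i ∈ A then z else 1), ← mul_assoc, ← Finset.prod_mul_distrib]
        have hone : (∏ x ∈ Tᶜ, (if x ∈ A then z⁻¹ else 1) * if x ∈ A then z else 1) = 1 := by
          refine Finset.prod_eq_one ?_
          intro i _
          split_ifs <;> simp [hz0]
        rw [hone, one_mul]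
  | zero => exact ⟨0, Submodule.zero_mem _, fun _ _ => rfl⟩
  | add x y _ _ hx hy =>
    obtain ⟨q, hq, h1⟩ := hx
    obtain ⟨q', hq', h1'⟩ := hy
    exact ⟨q + q', Submodule.add_mem _ hq hq', fun A hA => by simp [h1 A hA, h1' A hA]⟩
  | smul a x _ hx =>
    obtain ⟨q, hq, h1⟩ := hx
    exact ⟨a • q, Submodule.smul_mem _ _ hq, fun A hA => by simp [h1 A hA]⟩

/-- action of a polynomial in the shift on a sequence -/
def shiftAct {K : Type} [Field K] (q : Polynomial K) (f : ℕ → K) : ℕ → K :=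
  fun i => q.sum fun j c => c * f (i + j)

section
variable {K : Type} [Field K]

lemma shiftAct_zero (f : ℕ → K) : shiftAct 0 f = 0 := by ext i; simp [shiftAct]

lemma shiftAct_add (q r : Polynomial K) (f : ℕ → K) :
    shiftAct (q + r) f = shiftAct q f + shiftAct r f := by
  ext i
  simp only [shiftAct, Pi.add_apply]
  exact Polynomial.sum_add_index _ _ _ (by simp) (by intros; ring)

lemma shiftAct_monomial (j : ℕ) (c : K) (f : ℕ → K) (i : ℕ) :
    shiftAct (Polynomial.monomial j c) f i = c * f (i + j) := by
  simp only [shiftAct]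
  rw [Polynomial.sum_monomial_index]; simp

lemma shiftAct_mul (q r : Polynomial K) (f : ℕ → K) :
    shiftAct (q * r) f = shiftAct q (shiftAct r f) := by
  induction q using Polynomial.induction_on' with
  | add p q hp hq => rw [add_mul, shiftAct_add, shiftAct_add, hp, hq]
  | monomial j c =>
    induction r using Polynomial.induction_on' with
    | add p q hp hq =>
      rw [mul_add, shiftAct_add, hp, hq]
      ext i
      simp [shiftAct_monomial, shiftAct_add, mul_add]
    | monomial l e =>
      ext i
      rw [Polynomial.monomial_mul_monomial]
      simp only [shiftAct_monomial]
      rw [mul_assoc, show i + (j + l) = i + j + l by ring]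

lemma shiftAct_zero_right (q : Polynomial K) : shiftAct q (0 : ℕ → K) = 0 := by
  ext i; simp [shiftAct, Polynomial.sum]

lemma shiftAct_sub (q r : Polynomial K) (f : ℕ → K) :
    shiftAct (q - r) f = shiftAct q f - shiftAct r f := by
  have := shiftAct_add (q - r) r f
  rw [sub_add_cancel] at this
  rw [this]; simp

lemma shiftAct_X_pow (j : ℕ) (f : ℕ → K) (i : ℕ) :
    shiftAct (Polynomial.X ^ j) f i = f (i + j) := by
  rw [← Polynomial.monomial_one_right_eq_X_pow, shiftAct_monomial, one_mul]

lemma shiftAct_C (c : K) (f : ℕ → K) (i : ℕ) :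
    shiftAct (Polynomial.C c) f i = c * f i := by
  rw [← Polynomial.monomial_zero_left, shiftAct_monomial, add_zero]

lemma shiftAct_one (f : ℕ → K) : shiftAct 1 f = f := by
  ext i; rw [← Polynomial.C_1, shiftAct_C, one_mul]

/-- if μ kills u and u vanishes initially then u = 0 -/
lemma shiftAct_unique (μ : Polynomial K) (hμ : μ.Monic) (u : ℕ → K) (hu : shiftAct μ u = 0)
    (h0 : ∀ i < μ.natDegree, u i = 0) : u = 0 := by
  ext i
  induction i using Nat.strong_induction_on with
  | _ i ih =>
    by_cases hi : i < μ.natDegree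
    · exact h0 i hi
    · have := congrFun hu (i - μ.natDegree)
      simp only [shiftAct, Pi.zero_apply] at this
      rw [Polynomial.sum_over_range _ (by simp), Finset.sum_range_succ, Finset.sum_eq_zero,
        Polynomial.coeff_natDegree, hμ.leadingCoeff, zero_add, one_mul,
        Nat.sub_add_cancel (by omega)] at this
      · simpa using this
      · intro j hj
        rw [Finset.mem_range] at hj
        rw [ih _ (by omega)]; simp

/-- minimal annihilator -/
lemma exists_minAnn (f : ℕ → K) (P : Polynomial K) (hP : P ≠ 0) (hPf : shiftAct P f = 0) :
    ∃ μ : Polynomial K, μ.Monic ∧ shiftAct μ f = 0 ∧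
      ∀ q : Polynomial K, shiftAct q f = 0 → μ ∣ q := by
  let I : Ideal (Polynomial K) :=
    { carrier := {q | shiftAct q f = 0}
      add_mem' := by
        intro a b ha hb
        simp only [Set.mem_ofPred_eq] at *
        rw [shiftAct_add, ha, hb, add_zero]
      zero_mem' := shiftAct_zero f
      smul_mem' := by
        intro c x hx
        simp only [Set.mem_ofPred_eq, smul_eq_mul] at *
        rw [shiftAct_mul, hx, shiftAct_zero_right] }
  have hI : ∀ q, q ∈ I ↔ shiftAct q f = 0 := fun q => Iff.rfl
  set g := Submodule.IsPrincipal.generator I with hg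
  have hgI : ∀ q, q ∈ I ↔ g ∣ q := fun q => Submodule.IsPrincipal.mem_iff_generator_dvd I
  have hg0 : g ≠ 0 := by
    intro h
    have := (hgI P).1 ((hI P).2 hPf)
    rw [h, zero_dvd_iff] at this
    exact hP this
  refine ⟨g * Polynomial.C g.leadingCoeff⁻¹, Polynomial.monic_mul_leadingCoeff_inv hg0, ?_, ?_⟩
  · rw [← hI, hgI]; exact dvd_mul_right _ _
  · intro q hq
    rw [← hI, hgI] at hq
    have hu : IsUnit (Polynomial.C g.leadingCoeff⁻¹) :=
      Polynomial.isUnit_C.2 (by simpa using hg0)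
    exact (hu.mul_right_dvd).2 hq

/-- periodic sequences: f b-periodic -/
lemma ann_of_periodic (f : ℕ → K) (b : ℕ) (hf : ∀ i, f (i + b) = f i) :
    shiftAct (Polynomial.X ^ b - 1) f = 0 := by
  rw [shiftAct_sub, shiftAct_one]
  ext i
  simp [shiftAct_X_pow, hf]

lemma periodic_of_ann (f : ℕ → K) (b : ℕ) 
    (h : shiftAct (Polynomial.X ^ b - 1) f = 0) : ∀ i, f (i + b) = f i := by
  intro i
  rw [shiftAct_sub, shiftAct_one] at h
  have := congrFun h i
  simp only [Pi.sub_apply, shiftAct_X_pow, Pi.zero_apply] at this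
  exact sub_eq_zero.1 this

/-- Hankel invertibility: any values on a window of length ρ = deg μ are realized. -/
lemma window_interp (f : ℕ → K) (b : ℕ) (hb : 0 < b) (hf : ∀ i, f (i + b) = f i)
    (μ : Polynomial K) (hμ : μ.Monic) (hμf : shiftAct μ f = 0)
    (hmin : ∀ q : Polynomial K, shiftAct q f = 0 → μ ∣ q) (s : ℕ) (v : ℕ → K) :
    ∃ c : Fin μ.natDegree → K, ∀ i < μ.natDegree, ∑ j, c j * f (s + i + j) = v i := by
  classical
  set ρ := μ.natDegree with hρ
  let M : Matrix (Fin ρ) (Fin ρ) K := fun i j => f (s + i + j)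
  have hinj : Function.Injective M.mulVec := by
    rw [← Matrix.coe_mulVecLin, ← LinearMap.ker_eq_bot, LinearMap.ker_eq_bot']
    intro l hl
    rw [Matrix.mulVecLin_apply] at hl
    let Λ : Polynomial K := ∑ j : Fin ρ, Polynomial.monomial (j:ℕ) (l j)
    have hΛ : ∀ (g : ℕ → K) i, shiftAct Λ g i = ∑ j : Fin ρ, l j * g (i + j) := by
      intro g i
      have : ∀ t : Finset (Fin ρ), shiftAct (∑ j ∈ t, Polynomial.monomial (j:ℕ) (l j)) g i
          = ∑ j ∈ t, l j * g (i + j) := by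
        intro t
        induction t using Finset.induction_on with
        | empty => simp [shiftAct_zero]
        | insert a t ha ih =>
          rw [Finset.sum_insert ha, Finset.sum_insert ha, shiftAct_add, Pi.add_apply, ih,
            shiftAct_monomial]
      exact this _
    have hΛdeg : Λ.degree < ρ := by
      refine (Polynomial.degree_sum_le _ _).trans_lt ?_
      rw [Finset.sup_lt_iff (by exact WithBot.bot_lt_coe _)]
      intro j _
      exact (Polynomial.degree_monomial_le _ _).trans_lt (by exact_mod_cast j.2)
    have hcoef : ∀ j : Fin ρ, Λ.coeff j = l j := by
      intro j
      simp only [Λ, Polynomial.finsetSum_coeff, Polynomial.coeff_monomial]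
      rw [Finset.sum_eq_single j]
      · simp
      · intro a _ ha
        rw [if_neg]
        exact fun h => ha (Fin.ext h)
      · simp
    have hu : shiftAct (Polynomial.X ^ s * Λ) f = 0 := by
      apply shiftAct_unique μ hμ
      · rw [← shiftAct_mul, mul_comm, shiftAct_mul, hμf, shiftAct_zero_right]
      · intro i hi
        rw [shiftAct_mul, shiftAct_X_pow, hΛ]
        have := congrFun hl ⟨i, hi⟩
        simp only [Matrix.mulVec, dotProduct, M, Pi.zero_apply] at this
        rw [← this]
        refine Finset.sum_congr rfl fun j _ => ?_
        rw [mul_comm]; congr 2; ring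
    have hfk : ∀ t i, f (i + b * t) = f i := by
      intro t
      induction t with
      | zero => simp
      | succ t ih => intro i; rw [Nat.mul_succ, ← add_assoc, hf, ih]
    have hΛ0 : shiftAct Λ f = 0 := by
      ext i
      rw [hΛ]
      have := congrFun hu (i + (b * s - s))
      rw [shiftAct_mul, shiftAct_X_pow, hΛ] at this
      rw [Pi.zero_apply] at this ⊢
      rw [← this]
      refine Finset.sum_congr rfl fun j _ => ?_
      have h1 : i + (b * s - s) + s + j = i + j + b * s := by
        have : s ≤ b * s := Nat.le_mul_of_pos_left s hb
        omega
      rw [h1, hfk]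
    have hd := hmin Λ hΛ0
    have hz : Λ = 0 := by
      by_contra hne
      have := Polynomial.degree_le_of_dvd hd hne
      rw [Polynomial.degree_eq_natDegree hμ.ne_zero] at this
      exact absurd hΛdeg (not_lt.2 this)
    ext j
    rw [← hcoef, hz]; simp
  have hsurj : Function.Surjective M.mulVec := by
    rw [Matrix.mulVec_surjective_iff_isUnit]
    exact Matrix.mulVec_injective_iff_isUnit.1 hinj
  obtain ⟨c, hc⟩ := hsurj (fun i => v i)
  refine ⟨c, fun i hi => ?_⟩
  have := congrFun hc ⟨i, hi⟩
  simp only [Matrix.mulVec, dotProduct, M] at this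
  rw [← this]
  exact Finset.sum_congr rfl fun j _ => mul_comm _ _

/-- a root of the annihilator gives a geometric sequence -/
lemma geom_of_root (f : ℕ → K) 
    (μ : Polynomial K) (hμ : μ.Monic) (hμf : shiftAct μ f = 0)
    (hmin : ∀ q : Polynomial K, shiftAct q f = 0 → μ ∣ q) (z : K) (hz : μ.IsRoot z) :
    ∃ c : Fin μ.natDegree → K, ∀ i, ∑ j, c j * f (i + j) = z ^ i := by
  obtain ⟨Q, hQ⟩ := Polynomial.dvd_iff_isRoot.2 hz
  have hQ0 : Q ≠ 0 := by
    rintro rfl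
    exact hμ.ne_zero (by simpa using hQ)
  have hdeg : μ.natDegree = Q.natDegree + 1 := by
    rw [hQ, Polynomial.natDegree_mul (Polynomial.X_sub_C_ne_zero z) hQ0,
      Polynomial.natDegree_X_sub_C, add_comm]
  set u := shiftAct Q f with hu
  have hun : u ≠ 0 := by
    intro h
    have := Polynomial.natDegree_le_of_dvd (hmin Q h) hQ0
    omega
  have hrec : ∀ i, u (i+1) = z * u i := by
    intro i
    rw [hQ, shiftAct_mul, shiftAct_sub] at hμf
    have := congrFun hμf i
    rw [Pi.sub_apply, ← pow_one (Polynomial.X : Polynomial K), shiftAct_X_pow, shiftAct_C] at this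
    exact sub_eq_zero.1 this
  have hpow : ∀ i, u i = u 0 * z ^ i := by
    intro i
    induction i with
    | zero => simp
    | succ i ih => rw [hrec, ih]; ring
  have hu0 : u 0 ≠ 0 := by
    intro h
    exact hun (by ext i; rw [hpow, h]; simp)
  refine ⟨fun j => (u 0)⁻¹ * Q.coeff j, fun i => ?_⟩
  have : u i = ∑ j : Fin μ.natDegree, Q.coeff j * f (i + j) := by
    rw [hu]
    simp only [shiftAct]
    rw [Polynomial.sum_over_range _ (by simp), hdeg, Finset.sum_range]
  simp_rw [mul_assoc]
  rw [← Finset.mul_sum, ← this, hpow i]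
  field_simp

lemma periodic_gcd {α : Type} (f : ℕ → α) (b c : ℕ) (hfb : ∀ i, f (i + b) = f i)
    (hfc : ∀ i, f (i + c) = f i) : ∀ i, f (i + Nat.gcd c b) = f i := by
  induction c, b using Nat.gcd.induction with
  | H0 n => simpa using hfb
  | H1 m n hm ih =>
    rw [Nat.gcd_rec]
    refine ih hfc ?_
    have hk : ∀ t i, f (i + m * t) = f i := by
      intro t
      induction t with
      | zero => simp
      | succ t ih => intro i; rw [Nat.mul_succ, ← add_assoc, hfc, ih]
    intro i
    rw [← hk (n / m), add_assoc, Nat.mod_add_div, hfb]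

/-- case (i): existence of a root different from 1 -/
lemma exists_root_ne_one [IsAlgClosed K] (p : ℕ) [CharP K p] (hp : p = 0 ∨ p.Prime)
    (f : ℕ → K) (b : ℕ) (hb : 2 ≤ b)
    (hf : ∀ i, f (i + b) = f i) (hbmin : ∀ c, 1 ≤ c → (∀ i, f (i + c) = f i) → b ≤ c)
    (hnp : ¬ ∃ t : ℕ, b = p ^ t)
    (μ : Polynomial K) (hμ : μ.Monic) (hμf : shiftAct μ f = 0)
    (hmin : ∀ q : Polynomial K, shiftAct q f = 0 → μ ∣ q) :
    ∃ z : K, z ≠ 1 ∧ z ≠ 0 ∧ μ.IsRoot z := by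
  have hdvd : μ ∣ Polynomial.X ^ b - 1 := hmin _ (ann_of_periodic f b hf)
  by_contra hcon
  push Not at hcon
  have hroot : ∀ z, μ.IsRoot z → z = 1 := by
    intro z hz
    by_contra h1
    refine hcon z h1 ?_ hz
    rintro rfl
    have := hz.dvd hdvd
    simp [Polynomial.IsRoot, show b ≠ 0 by omega] at this
  -- μ = (X - 1)^N
  have hsplit : μ = (Polynomial.X - Polynomial.C 1) ^ μ.natDegree := by
    have h1 := (IsAlgClosed.splits μ)
    have h2 : μ.roots = Multiset.replicate μ.natDegree 1 := by
      rw [Multiset.eq_replicate]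
      refine ⟨?_, fun z hz => hroot z (Polynomial.isRoot_of_mem_roots hz)⟩
      exact h1.natDegree_eq_card_roots.symm
    have h3 := h1.eq_prod_roots_of_monic hμ
    rw [h2] at h3
    simpa using h3
  rcases hp with rfl | hp
  · have : CharZero K := CharP.charP_to_charZero K
    have hsep : (Polynomial.X ^ b - 1 : Polynomial K).Separable := by
      have := Polynomial.separable_X_pow_sub_C (1:K) (n := b)
        (by exact_mod_cast (by omega : b ≠ 0)) one_ne_zero
      simpa using this
    have hsq : Squarefree μ := (hsep.of_dvd hdvd).squarefree
    have hN : μ.natDegree ≤ 1 := by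
      by_contra hN
      rw [hsplit] at hsq
      have := hsq (Polynomial.X - Polynomial.C 1) (by
        rw [← pow_two]; exact pow_dvd_pow _ (by omega))
      exact Polynomial.not_isUnit_X_sub_C _ this
    have hd : μ ∣ Polynomial.X ^ 1 - 1 := by
      conv_lhs => rw [hsplit]
      have := pow_dvd_pow (Polynomial.X - Polynomial.C (1:K)) hN
      simpa using this
    obtain ⟨r, hr⟩ := hd
    have := hbmin 1 le_rfl (periodic_of_ann f 1 (by
      rw [hr, mul_comm, shiftAct_mul, hμf, shiftAct_zero_right]))
    omega
  · have : Fact p.Prime := ⟨hp⟩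
    have hd : μ ∣ Polynomial.X ^ (p ^ μ.natDegree) - 1 := by
      have h1 : (Polynomial.X ^ (p ^ μ.natDegree) - 1 : Polynomial K) =
          (Polynomial.X - Polynomial.C 1) ^ (p ^ μ.natDegree) := by
        rw [sub_pow_char_pow]; simp
      rw [h1]
      conv_lhs => rw [hsplit]
      exact pow_dvd_pow _ (Nat.lt_pow_self hp.one_lt).le
    obtain ⟨r, hr⟩ := hd
    have hper := periodic_of_ann f _ (by
      rw [hr, mul_comm, shiftAct_mul, hμf, shiftAct_zero_right])
    have hg := periodic_gcd f b _ hf hper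
    have hle := hbmin _ (Nat.gcd_pos_of_pos_right _ (by omega)) hg
    have hle2 : Nat.gcd (p ^ μ.natDegree) b = b :=
      le_antisymm (Nat.gcd_le_right _ (by omega)) hle
    have hdv : b ∣ p ^ μ.natDegree := by rw [← hle2]; exact Nat.gcd_dvd_left _ _
    obtain ⟨t, _, ht⟩ := (Nat.dvd_prime_pow hp).1 hdv
    exact hnp ⟨t, ht⟩

/-- subsampling -/
lemma shiftAct_expand (q : ℕ) (Q : Polynomial K) (f : ℕ → K) (i0 : ℕ)
    (u : ℕ) : shiftAct (Q.comp (Polynomial.X ^ q)) f (i0 + q * u)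
      = shiftAct Q (fun u => f (i0 + q * u)) u := by
  induction Q using Polynomial.induction_on' with
  | add r s hr hs => rw [Polynomial.add_comp, shiftAct_add, shiftAct_add, Pi.add_apply, hr, hs,
      Pi.add_apply]
  | monomial j c =>
    rw [Polynomial.monomial_comp, ← pow_mul, ← Polynomial.monomial_one_right_eq_X_pow,
      Polynomial.C_mul_monomial, shiftAct_monomial, shiftAct_monomial, mul_one]
    congr 2; ring

/-- boolean-valued low-degree sequences are constant -/
lemma bool_const (p : ℕ) [hp : Fact p.Prime] [CharP K p] (f : ℕ → K) (hB : ∀ i, f i = 0 ∨ f i = 1)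
    (k : ℕ) (hk : 2 * k ≤ p + 1) (hf : shiftAct ((Polynomial.X - 1) ^ k) f = 0) :
    ∀ i, f (i + 1) = f i := by
  have hp1 := hp.out.two_le
  -- Newton expansion
  have hfd : ∀ (j i : ℕ), (fwdDiff 1)^[j] f i = shiftAct ((Polynomial.X - 1) ^ j) f i := by
    intro j
    induction j with
    | zero => intro i; simp [shiftAct_one]
    | succ j ih =>
      intro i
      rw [Function.iterate_succ_apply', fwdDiff, ih, ih, pow_succ', shiftAct_mul, shiftAct_sub,
        shiftAct_one, Pi.sub_apply]
      congr 1
      rw [← pow_one (Polynomial.X : Polynomial K), shiftAct_X_pow]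
  have hzero : ∀ j i, k ≤ j → (fwdDiff 1)^[j] f i = 0 := by
    intro j i hj
    rw [hfd, ← Nat.sub_add_cancel hj, pow_add, shiftAct_mul, hf, shiftAct_zero_right]
    rfl
  have hNewton : ∀ u : ℕ, f u = ∑ j ∈ Finset.range k, (u.choose j : K) * (fwdDiff 1)^[j] f 0 := by
    intro u
    have h1 := shift_eq_sum_fwdDiff_iter (1:ℕ) f u 0
    simp only [smul_eq_mul, mul_one, zero_add, nsmul_eq_mul] at h1
    rw [h1]
    rcases le_total k (u+1) with h | h
    · symm
      refine Finset.sum_subset (Finset.range_mono h) ?_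
      intro j _ hj
      rw [Finset.mem_range, not_lt] at hj
      rw [hzero j 0 hj, mul_zero]
    · refine Finset.sum_subset (Finset.range_mono h) ?_
      intro j _ hj
      rw [Finset.mem_range, not_lt] at hj
      rw [Nat.choose_eq_zero_of_lt (by omega)]; simp
  -- polynomial
  let Q : Polynomial K := ∑ j ∈ Finset.range k,
    Polynomial.C ((fwdDiff 1)^[j] f 0 * (j.factorial : K)⁻¹) * descPochhammer K j
  have hQ : ∀ u : ℕ, Q.eval (u : K) = f u := by
    intro u
    rw [hNewton u]
    simp only [Q, Polynomial.eval_finsetSum, Polynomial.eval_mul, Polynomial.eval_C]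
    refine Finset.sum_congr rfl fun j hj => ?_
    rw [Finset.mem_range] at hj
    rw [descPochhammer_eval_eq_descFactorial, Nat.descFactorial_eq_factorial_mul_choose]
    have : (j.factorial : K) ≠ 0 := by
      rw [Ne, CharP.cast_eq_zero_iff K p, hp.out.dvd_factorial]
      omega
    push_cast
    field_simp
  have hQdeg : ∀ hk0 : 0 < k, Q.natDegree ≤ k - 1 := by
    intro hk0
    refine Polynomial.natDegree_sum_le_of_forall_le _ _ fun j hj => ?_
    rw [Finset.mem_range] at hj
    refine (Polynomial.natDegree_C_mul_le _ _).trans ?_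
    rw [descPochhammer_natDegree]; omega
  have hQQ : Q * Q - Q = 0 := by
    rcases Nat.eq_zero_or_pos k with rfl | hk0
    · simp [Q]
    · apply Polynomial.eq_zero_of_natDegree_lt_card_of_eval_eq_zero (ι := Fin p) _
        (f := fun u : Fin p => ((u : ℕ) : K))
      · intro a b hab
        simp only at hab
        have := (CharP.natCast_eq_natCast K p).1 hab
        exact Fin.ext (Nat.ModEq.eq_of_lt_of_lt this a.2 b.2)
      · intro u
        rw [Polynomial.eval_sub, Polynomial.eval_mul, hQ]
        rcases hB u with h | h <;> simp [h]
      · rw [Fintype.card_fin]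
        have h1 := hQdeg hk0
        have h2 := Polynomial.natDegree_mul_le (p := Q) (q := Q)
        have h3 := Polynomial.natDegree_sub_le (Q * Q) Q
        omega
  have hQ01 : Q = 0 ∨ Q = 1 := by
    have : Q * (Q - 1) = 0 := by rw [← hQQ]; ring
    rcases mul_eq_zero.1 this with h | h
    · exact Or.inl h
    · exact Or.inr (sub_eq_zero.1 h)
  intro i
  rw [← hQ, ← hQ]
  rcases hQ01 with h | h <;> simp [h]

/-- case (ii): the annihilator has large degree -/
lemma ann_degree_large (p : ℕ) [hp : Fact p.Prime] [CharP K p] (f : ℕ → K)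
    (hB : ∀ i, f i = 0 ∨ f i = 1) (t b : ℕ) (hb : 2 ≤ b) (hbt : b = p ^ t)
    (hf : ∀ i, f (i + b) = f i) (hbmin : ∀ c, 1 ≤ c → (∀ i, f (i + c) = f i) → b ≤ c)
    (μ : Polynomial K) (hμ : μ.Monic) (hμf : shiftAct μ f = 0)
    (hmin : ∀ q : Polynomial K, shiftAct q f = 0 → μ ∣ q) :
    b ≤ 2 * μ.natDegree ∧ μ.natDegree ≤ b := by
  have hp1 := hp.out.two_le
  have hpol : (Polynomial.X ^ b - 1 : Polynomial K) = (Polynomial.X - Polynomial.C 1) ^ b := by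
    rw [hbt, sub_pow_char_pow]; simp
  have hdvd : μ ∣ (Polynomial.X - Polynomial.C 1) ^ b := by
    rw [← hpol]; exact hmin _ (ann_of_periodic f b hf)
  have hdeg : μ.natDegree ≤ b := by
    have := Polynomial.natDegree_le_of_dvd hdvd (pow_ne_zero _ (Polynomial.X_sub_C_ne_zero 1))
    rwa [Polynomial.natDegree_pow, Polynomial.natDegree_X_sub_C, mul_one] at this
  refine ⟨?_, hdeg⟩
  by_contra hlt
  push Not at hlt
  obtain ⟨t, rfl⟩ : ∃ s, t = s + 1 := by
    cases t with
    | zero => simp at hbt; omega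
    | succ s => exact ⟨s, rfl⟩
  set q := p ^ t with hq
  have hq0 : 0 < q := pow_pos (by omega) _
  have hbq : b = q * p := by rw [hbt, pow_succ]
  set k := (p + 1) / 2 with hk
  have hkq : μ.natDegree ≤ q * k := by
    have : p ≤ 2 * k := by omega
    have : q * p ≤ q * (2 * k) := Nat.mul_le_mul_left _ this
    nlinarith
  obtain ⟨N, hN, hass⟩ := (dvd_prime_pow (Polynomial.prime_X_sub_C (1:K)) _).1 hdvd
  have hμeq : μ = (Polynomial.X - Polynomial.C 1) ^ N :=
    Polynomial.eq_of_monic_of_associated hμ ((Polynomial.monic_X_sub_C 1).pow N) hass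
  have hNdeg : N = μ.natDegree := by
    rw [hμeq, Polynomial.natDegree_pow, Polynomial.natDegree_X_sub_C, mul_one]
  have hd : μ ∣ ((Polynomial.X - 1 : Polynomial K) ^ k).comp (Polynomial.X ^ q) := by
    have : ((Polynomial.X - 1 : Polynomial K) ^ k).comp (Polynomial.X ^ q) =
        (Polynomial.X - Polynomial.C 1) ^ (q * k) := by
      rw [pow_mul, hq, sub_pow_char_pow]; simp
    rw [this, hμeq]
    exact pow_dvd_pow _ (by omega)
  obtain ⟨r, hr⟩ := hd
  have hkill : shiftAct (((Polynomial.X - 1 : Polynomial K) ^ k).comp (Polynomial.X ^ q)) f = 0 := by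
    rw [hr, mul_comm, shiftAct_mul, hμf, shiftAct_zero_right]
  have hper : ∀ i, f (i + q) = f i := by
    intro i
    have h1 : shiftAct ((Polynomial.X - 1 : Polynomial K) ^ k) (fun u => f (i + q * u)) = 0 := by
      ext u
      rw [← shiftAct_expand, hkill]; rfl
    have := bool_const p _ (fun u => hB (i + q * u)) k (by omega) h1 0
    simpa using this
  have := hbmin q hq0 hper
  nlinarith
end

/-- general-index version of `∃ P, deg ≤ d, err ≤ ε`. -/
def HasPoly (F : Type) [Field F] {n : ℕ} (g : (Fin n → Bool) → Bool) (d : ℕ) (ε : ℝ) : Prop :=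
  ∃ (ι : Type) (_ : Fintype ι) (w : ι → ℝ) (P : ι → MvPolynomial (Fin n) F) (β : ι → (Fin n → Bool) → ℝ),
    (∀ i, 0 ≤ w i) ∧ ∑ i, w i = 1 ∧ (∀ i, (P i).totalDegree ≤ d) ∧
    (∀ i a, (β i a = 0 ∧ MvPolynomial.eval (fun v => bF F (a v)) (P i) = bF F (g a)) ∨ β i a = 1) ∧
    ∀ a, ∑ i, w i * β i a ≤ ε

lemma HasPoly.mono {F : Type} [Field F] {n : ℕ} {g : (Fin n → Bool) → Bool} {d : ℕ} {ε ε' : ℝ}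
    (h : HasPoly F g d ε) (hε : ε ≤ ε') : HasPoly F g d ε' := by
  obtain ⟨ι, i1, w, P, β, h1, h2, h3, h4, h5⟩ := h
  exact ⟨ι, i1, w, P, β, h1, h2, h3, h4, fun a => (h5 a).trans hε⟩

lemma pdeg_spec_s15 (F : Type) [Field F] {n : ℕ} (g : (Fin n → Bool) → Bool) (ε : ℝ) (hε : 0 ≤ ε) :
    HasPoly F g (pdeg F g ε) ε := by
  classical
  have hne : {d | ∃ P : ProbPoly F n, (∀ i, (P.poly i).totalDegree ≤ d) ∧
      ∀ a, errAt P g a ≤ ε}.Nonempty := by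
    let Q : MvPolynomial (Fin n) F := ∑ a : Fin n → Bool, MvPolynomial.C (bF F (g a)) *
      ∏ v, (if a v then MvPolynomial.X v else 1 - MvPolynomial.X v)
    refine ⟨Q.totalDegree, ⟨1, fun _ => 1, fun _ => zero_le_one, by simp, fun _ => Q⟩,
      fun _ => le_rfl, fun a => ?_⟩
    have : MvPolynomial.eval (fun v => bF F (a v)) Q = bF F (g a) := by
      simp only [Q, map_sum, map_mul, MvPolynomial.eval_C, map_prod]
      rw [Finset.sum_eq_single a]
      · rw [Finset.prod_eq_one, mul_one]
        intro v _
        by_cases h : a v <;> simp [h, bF]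
      · intro c _ hc
        obtain ⟨v, hv⟩ := Function.ne_iff.1 hc
        rw [Finset.prod_eq_zero (Finset.mem_univ v), mul_zero]
        by_cases h : a v <;> by_cases h' : c v <;> simp_all [bF]
      · simp
    simp [errAt, this, hε]
  obtain ⟨P, hP, hE⟩ := Nat.sInf_mem hne
  refine ⟨Fin P.k, inferInstance, P.w, P.poly, fun i a =>
    if MvPolynomial.eval (fun v => bF F (a v)) (P.poly i) = bF F (g a) then 0 else 1,
    P.w_nonneg, P.w_sum, hP, ?_, ?_⟩
  · intro i a
    by_cases h : MvPolynomial.eval (fun v => bF F (a v)) (P.poly i) = bF F (g a) <;> simp [h]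
  · intro a
    refine le_trans (le_of_eq ?_) (hE a)
    unfold errAt
    refine Finset.sum_congr rfl fun i _ => ?_
    by_cases h : MvPolynomial.eval (fun v => bF F (a v)) (P.poly i) = bF F (g a) <;> simp [h]

lemma HasPoly.amp {F : Type} [Field F] {n : ℕ} {g : (Fin n → Bool) → Bool} {d : ℕ} {ε : ℝ}
    (h : HasPoly F g d ε) (hε : ε ≤ 1) : HasPoly F g (3 * d) (3 * ε ^ 2 - 2 * ε ^ 3) := by
  obtain ⟨ι, i1, w, P, β, h1, h2, h3, h4, h5⟩ := h
  refine ⟨ι × ι × ι, inferInstance, fun x => w x.1 * w x.2.1 * w x.2.2,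
    fun x => P x.1 * P x.2.1 + P x.2.1 * P x.2.2 + P x.1 * P x.2.2
      - MvPolynomial.C 2 * (P x.1 * P x.2.1 * P x.2.2),
    fun x a => β x.1 a * β x.2.1 a + β x.2.1 a * β x.2.2 a + β x.1 a * β x.2.2 a
      - 2 * (β x.1 a * β x.2.1 a * β x.2.2 a), ?_, ?_, ?_, ?_, ?_⟩
  · intro x
    exact mul_nonneg (mul_nonneg (h1 _) (h1 _)) (h1 _)
  · simp only [Fintype.sum_prod_type]
    simp only [← Finset.mul_sum, h2, mul_one]
  · rintro ⟨i, j, l⟩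
    have a1 := h3 i
    have a2 := h3 j
    have a3 := h3 l
    have hm : ∀ A B : MvPolynomial (Fin n) F, (A * B).totalDegree ≤ A.totalDegree + B.totalDegree :=
      fun A B => MvPolynomial.totalDegree_mul A B
    refine (MvPolynomial.totalDegree_sub _ _).trans (max_le ?_ ?_)
    · refine (MvPolynomial.totalDegree_add _ _).trans (max_le ?_ ?_)
      · refine (MvPolynomial.totalDegree_add _ _).trans (max_le ?_ ?_)
        · exact (hm _ _).trans (by simp only; omega)
        · exact (hm _ _).trans (by simp only; omega)
      · exact (hm _ _).trans (by simp only; omega)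
    · refine (hm _ _).trans ?_
      rw [MvPolynomial.totalDegree_C]
      have b1 := hm (P i * P j) (P l)
      have b2 := hm (P i) (P j)
      simp only; omega
  · rintro ⟨i, j, l⟩ a
    simp only [map_sub, map_add, map_mul, MvPolynomial.eval_C]
    have hb : bF F (g a) = 0 ∨ bF F (g a) = 1 := by
      cases g a <;> simp [bF]
    rcases h4 i a with ⟨ei, hi⟩ | ei <;> rcases h4 j a with ⟨ej, hj⟩ | ej <;>
      rcases h4 l a with ⟨el, hl⟩ | el <;> rw [ei, ej, el]
    · left; rw [hi, hj, hl]; rcases hb with h | h <;> rw [h] <;> norm_num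
    · left; rw [hi, hj]; rcases hb with h | h <;> rw [h] <;> exact ⟨by ring, by ring⟩
    · left; rw [hi, hl]; rcases hb with h | h <;> rw [h] <;> exact ⟨by ring, by ring⟩
    · right; norm_num
    · left; rw [hj, hl]; rcases hb with h | h <;> rw [h] <;> exact ⟨by ring, by ring⟩
    · right; norm_num
    · right; norm_num
    · right; norm_num
  · intro a
    set e := ∑ i, w i * β i a with he
    have hsum : ∑ x : ι × ι × ι, w x.1 * w x.2.1 * w x.2.2 *
        (β x.1 a * β x.2.1 a + β x.2.1 a * β x.2.2 a + β x.1 a * β x.2.2 a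
      - 2 * (β x.1 a * β x.2.1 a * β x.2.2 a)) = 3 * e ^ 2 - 2 * e ^ 3 := by
      have hz : ∀ i j l, w i * w j * w l *
        (β i a * β j a + β j a * β l a + β i a * β l a - 2 * (β i a * β j a * β l a)) =
          (w i * β i a) * ((w j * β j a) * w l) + w i * ((w j * β j a) * (w l * β l a))
          + (w i * β i a) * (w j * (w l * β l a))
          - 2 * ((w i * β i a) * ((w j * β j a) * (w l * β l a))) := by
        intros; ring
      simp only [Fintype.sum_prod_type, hz]
      simp only [Finset.sum_add_distrib, Finset.sum_sub_distrib, ← Finset.mul_sum, ← he, h2,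
        ← Finset.sum_mul]
      ring
    rw [hsum]
    have he0 : 0 ≤ e := by
      refine Finset.sum_nonneg fun i _ => mul_nonneg (h1 i) ?_
      rcases h4 i a with ⟨h, _⟩ | h <;> simp [h]
    have hee : e ≤ ε := h5 a
    have h1e : 0 ≤ 1 - ε := by linarith
    nlinarith [mul_nonneg he0 (sub_nonneg.2 hee), mul_nonneg h1e (sub_nonneg.2 hee),
      mul_nonneg (mul_nonneg he0 h1e) (sub_nonneg.2 hee),
      mul_nonneg (mul_nonneg h1e (he0.trans hee)) (sub_nonneg.2 hee),
      mul_nonneg (sub_nonneg.2 (hee.trans hε)) (mul_nonneg he0 (sub_nonneg.2 hee)),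
      mul_nonneg (sub_nonneg.2 (hee.trans hε)) (mul_nonneg (he0.trans hee) (sub_nonneg.2 hee)),
      pow_nonneg (sub_nonneg.2 hee) 2, pow_nonneg (sub_nonneg.2 hee) 3]

lemma HasPoly.amp_iter {F : Type} [Field F] {n : ℕ} {g : (Fin n → Bool) → Bool} {d : ℕ}
    (h : HasPoly F g d (1/3)) (t : ℕ) : HasPoly F g (3 ^ (t+1) * d) ((7/9 : ℝ) ^ (2 ^ t) / 3) := by
  induction t with
  | zero =>
    refine (h.amp (by norm_num)).mono ?_
    norm_num
  | succ t ih =>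
    have hx : 0 ≤ (7/9 : ℝ) ^ (2 ^ t) := by positivity
    have hx1 : (7/9 : ℝ) ^ (2 ^ t) ≤ 1 := pow_le_one₀ (by norm_num) (by norm_num)
    have := (ih.amp (by linarith)).mono (ε' := (7/9 : ℝ) ^ (2 ^ (t+1)) / 3) (by
      rw [pow_succ 2 t, pow_mul]
      nlinarith [pow_nonneg hx 3])
    rw [pow_succ' 3 (t+1), mul_assoc]
    exact this

/-- restriction embedding -/
def phiR (n m j : ℕ) (A : Finset (Fin m)) : Fin n → Bool :=
  fun v => if h : v.1 < m then decide (⟨v.1, h⟩ ∈ A) else decide (v.1 < m + j)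

lemma wt_phiR (n m j : ℕ) (h : m + j ≤ n) (A : Finset (Fin m)) :
    wt (phiR n m j A) = A.card + j := by
  classical
  unfold wt
  have : (Finset.univ.filter fun i => phiR n m j A i = true) =
      A.map (Fin.castLEEmb (show m ≤ n by omega)) ∪
        (Finset.univ.filter fun v : Fin n => m ≤ v.1 ∧ v.1 < m + j) := by
    ext v
    simp only [Finset.mem_filter, Finset.mem_univ, true_and, Finset.mem_union, Finset.mem_map]
    rw [phiR]
    by_cases hv : v.1 < m
    · rw [dif_pos hv, decide_eq_true_eq]
      constructor
      · intro hA
        exact Or.inl ⟨_, hA, by ext; simp⟩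
      · rintro (⟨x, hx, rfl⟩ | ⟨h1, _⟩)
        · simpa using hx
        · omega
    · rw [dif_neg hv, decide_eq_true_eq]
      constructor
      · intro h1; exact Or.inr ⟨by omega, h1⟩
      · rintro (⟨x, hx, rfl⟩ | ⟨_, h1⟩)
        · exact absurd x.2 (by simpa using hv)
        · exact h1
  rw [this, Finset.card_union_of_disjoint, Finset.card_map]
  · congr 1
    rw [← Finset.card_map Fin.valEmbedding]
    have : (Finset.univ.filter fun v : Fin n => m ≤ v.1 ∧ v.1 < m + j).map Fin.valEmbedding
        = Finset.Ico m (m + j) := by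
      ext x
      simp only [Finset.mem_map, Finset.mem_filter, Finset.mem_univ, true_and, Finset.mem_Ico,
        Fin.valEmbedding_apply]
      constructor
      · rintro ⟨v, hv, rfl⟩; exact hv
      · intro hx; exact ⟨⟨x, by omega⟩, hx, rfl⟩
    rw [this]; simp
  · rw [Finset.disjoint_left]
    intro v hv hv'
    simp only [Finset.mem_map, Finset.mem_filter, Finset.mem_univ, true_and] at hv hv'
    obtain ⟨x, _, rfl⟩ := hv
    have := x.2
    simp at hv'
    omega

lemma core_restrict {F : Type} [Field F] (K : Type) [Field K] [Algebra F K] {n : ℕ}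
    {g : (Fin n → Bool) → Bool} {d : ℕ} {ε : ℝ} (h : HasPoly F g d ε) (m J : ℕ) :
    ∃ G : ℕ → Finset (Fin m) → K, (∀ j, G j ∈ PolyLE K m d) ∧
      ∃ Bad : Finset (Finset (Fin m)), (Bad.card : ℝ) ≤ J * ε * 2 ^ m ∧
        ∀ A ∉ Bad, ∀ j < J, G j A = if g (phiR n m j A) then 1 else 0 := by
  classical
  obtain ⟨ι, i1, w, P, β, h1, h2, h3, h4, h5⟩ := h
  let Bad : ι → Finset (Finset (Fin m)) := fun i =>
    Finset.univ.filter fun A => ∃ j < J, β i (phiR n m j A) = 1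
  have hβ : ∀ i a, 0 ≤ β i a := by
    intro i a; rcases h4 i a with ⟨h, _⟩ | h <;> simp [h]
  have hcard : ∀ i, ((Bad i).card : ℝ) ≤ ∑ A : Finset (Fin m), ∑ j ∈ Finset.range J,
      β i (phiR n m j A) := by
    intro i
    rw [Finset.card_filter]
    push_cast
    refine Finset.sum_le_sum fun A _ => ?_
    split_ifs with hA
    · obtain ⟨j, hj, hb⟩ := hA
      rw [← hb]
      exact Finset.single_le_sum (f := fun j => β i (phiR n m j A)) (fun j _ => hβ _ _)
        (Finset.mem_range.2 hj)
    · exact Finset.sum_nonneg fun j _ => hβ _ _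
  have hex : ∃ i, ((Bad i).card : ℝ) ≤ J * ε * 2 ^ m := by
    by_contra hcon
    push Not at hcon
    have hne : ∃ i, 0 < w i := by
      by_contra hw
      push Not at hw
      have : ∑ i, w i ≤ 0 := Finset.sum_nonpos fun i _ => hw i
      linarith
    obtain ⟨i0, hi0⟩ := hne
    have hlt : ∑ i, w i * (J * ε * 2 ^ m) < ∑ i, w i * ((Bad i).card : ℝ) := by
      refine Finset.sum_lt_sum (fun i _ => mul_le_mul_of_nonneg_left (hcon i).le (h1 i))
        ⟨i0, Finset.mem_univ _, mul_lt_mul_of_pos_left (hcon i0) hi0⟩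
    rw [← Finset.sum_mul, h2, one_mul] at hlt
    have hle : ∑ i, w i * ((Bad i).card : ℝ) ≤ J * ε * 2 ^ m := by
      calc ∑ i, w i * ((Bad i).card : ℝ)
          ≤ ∑ i, w i * ∑ A : Finset (Fin m), ∑ j ∈ Finset.range J, β i (phiR n m j A) :=
            Finset.sum_le_sum fun i _ => mul_le_mul_of_nonneg_left (hcard i) (h1 i)
        _ = ∑ A : Finset (Fin m), ∑ j ∈ Finset.range J, ∑ i, w i * β i (phiR n m j A) := by
            simp only [Finset.mul_sum]
            rw [Finset.sum_comm]
            refine Finset.sum_congr rfl fun A _ => ?_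
            rw [Finset.sum_comm]
        _ ≤ ∑ A : Finset (Fin m), ∑ j ∈ Finset.range J, ε :=
            Finset.sum_le_sum fun A _ => Finset.sum_le_sum fun j _ => h5 _
        _ = J * ε * 2 ^ m := by
            simp; ring
    linarith
  obtain ⟨i, hi⟩ := hex
  refine ⟨fun j A => MvPolynomial.aeval (fun v => (if phiR n m j A v then (1:K) else 0)) (P i),
    fun j => ?_, Bad i, hi, ?_⟩
  · refine PolyLE_aeval (P i) (h3 i) (fun v A => if phiR n m j A v then (1:K) else 0) fun v => ?_
    by_cases hv : v.1 < m
    · have : (fun A => if phiR n m j A v then (1:K) else 0) = chiM K {⟨v.1, hv⟩} := by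
        ext A
        simp [phiR, hv, chiM]
      rw [this]
      exact chiM_mem _ (by simp)
    · by_cases hv' : v.1 < m + j
      · have : (fun A => if phiR n m j A v then (1:K) else 0) = 1 := by
          ext A
          simp [phiR, hv, hv']
        rw [this]; exact PolyLE_one
      · have : (fun A => if phiR n m j A v then (1:K) else 0) = 0 := by
          ext A
          simp [phiR, hv, hv']
        rw [this]; exact Submodule.zero_mem _
  · intro A hA j hj
    have hb : β i (phiR n m j A) ≠ 1 := by
      intro hb
      exact hA (Finset.mem_filter.2 ⟨Finset.mem_univ _, j, hj, hb⟩)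
    have he := (h4 i (phiR n m j A)).resolve_right hb
    have hfun : (fun v => (if phiR n m j A v then (1:K) else 0)) =
        fun v => algebraMap F K (bF F (phiR n m j A v)) := by
      ext v; unfold bF; split_ifs <;> simp
    simp only
    rw [hfun]
    have := MvPolynomial.aeval_algebraMap_apply K (fun v => bF F (phiR n m j A v)) (P i)
    refine this.trans ?_
    rw [MvPolynomial.aeval_eq_eval]
    rw [show ((MvPolynomial.eval fun v => bF F (phiR n m j A v)) (P i)) = _ from he.2]
    unfold bF
    split_ifs <;> simp

lemma trivial_bound {F : Type} [Field F] {n : ℕ} {g : (Fin n → Bool) → Bool} {d : ℕ} {ε : ℝ}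
    (h : HasPoly F g d ε) (hε : ε ≤ 1/3) (a a' : Fin n → Bool) (hg : g a ≠ g a') : 1 ≤ d := by
  by_contra hd
  obtain ⟨ι, i1, w, P, β, h1, h2, h3, h4, h5⟩ := h
  have hone : ∀ i, 1 ≤ β i a + β i a' := by
    intro i
    rcases h4 i a with ⟨e, he⟩ | e <;> rcases h4 i a' with ⟨e', he'⟩ | e' <;> rw [e, e'] <;>
      try norm_num
    exfalso
    have h0 : (P i).totalDegree = 0 := by have := h3 i; omega
    rw [MvPolynomial.totalDegree_eq_zero_iff_eq_C] at h0
    rw [h0] at he he'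
    simp only [MvPolynomial.eval_C] at he he'
    have : bF F (g a) = bF F (g a') := by rw [← he, he']
    apply hg
    cases hx : g a <;> cases hy : g a' <;> simp_all [bF]
  have h6 := h5 a
  have h7 := h5 a'
  have : ∑ i, w i ≤ ∑ i, w i * β i a + ∑ i, w i * β i a' := by
    rw [← Finset.sum_add_distrib]
    refine Finset.sum_le_sum fun i _ => ?_
    nlinarith [h1 i, hone i]
  linarith

lemma bin_step (h i : ℕ) (hi : i ≤ h) :
    ((2*h).choose (h+(i+1)) : ℝ) * (h + i + 1) = (2*h).choose (h+i) * (h - i) := by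
  have := Nat.choose_succ_right_eq (2*h) (h+i)
  have h2 : 2*h - (h+i) = h - i := by omega
  rw [h2] at this
  have h3 : (((2*h).choose (h+i+1) * (h+i+1) : ℕ) : ℝ) = (((2*h).choose (h+i) * (h-i) : ℕ) : ℝ) := by
    rw [this]
  push_cast [Nat.cast_sub hi] at h3
  rw [← add_assoc]
  exact h3

lemma bin_anti (h i j : ℕ) (hij : i ≤ j) : (2*h).choose (h+j) ≤ (2*h).choose (h+i) := by
  induction j, hij using Nat.le_induction with
  | base => exact le_rfl
  | succ j hj ih =>
    refine le_trans ?_ ih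
    by_cases hjh : j ≤ h
    · have := bin_step h j hjh
      have hx : (0:ℝ) ≤ (2*h).choose (h+(j+1)) := by positivity
      have hy : (0:ℝ) ≤ (2*h).choose (h+j) := by positivity
      have hj0 : (0:ℝ) ≤ j := by positivity
      have hjh' : (j:ℝ) ≤ h := by exact_mod_cast hjh
      have : ((2*h).choose (h+(j+1)) : ℝ) ≤ (2*h).choose (h+j) := by
        by_contra hcon
        push Not at hcon
        nlinarith
      exact_mod_cast this
    · rw [Nat.choose_eq_zero_of_lt (by omega)]; simp

lemma bin_lower (h k : ℕ) (hk : 1 ≤ k) (hkh : 2*k ≤ h) :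
    (4:ℝ)^h / (2*h) * Real.exp (-(4*k^2/h)) ≤ (2*h).choose (h+k) := by
  have hh : (0:ℝ) < h := by exact_mod_cast (by omega : 0 < h)
  have hk0 : (0:ℝ) < k := by exact_mod_cast (by omega : 0 < k)
  have hkh' : 2*(k:ℝ) ≤ h := by exact_mod_cast hkh
  set y : ℝ := Real.exp (-(4*k/h)) with hy
  have hy0 : 0 < y := Real.exp_pos _
  have hyle : y ≤ (h-k)/(h+k) := by
    have hpos : (0:ℝ) < (h-k)/(h+k) := div_pos (by linarith) (by linarith)
    rw [hy, ← Real.le_log_iff_exp_le hpos]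
    refine le_trans ?_ (Real.one_sub_inv_le_log_of_pos hpos)
    rw [inv_div]
    have h1 : (1:ℝ) - (h+k)/(h-k) = -(2*k/(h-k)) := by
      have : (h:ℝ) - k ≠ 0 := by linarith
      field_simp; ring
    rw [h1, neg_le_neg_iff, div_le_div_iff₀ (by linarith) hh]
    nlinarith
  have hstep : ∀ i ≤ k, ((2*h).choose h : ℝ) * y ^ i ≤ (2*h).choose (h+i) := by
    intro i
    induction i with
    | zero => simp
    | succ i ih =>
      intro hi
      have h1 := ih (by omega)
      have h2 := bin_step h i (by omega)
      have hik : (i:ℝ) + 1 ≤ k := by exact_mod_cast hi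
      have hi0 : (0:ℝ) ≤ i := by positivity
      have h3 : y ≤ (h-i)/(h+i+1) := by
        refine hyle.trans ?_
        apply div_le_div₀ <;> linarith
      have h4 : ((2*h).choose (h+(i+1)) : ℝ) = (2*h).choose (h+i) * ((h - i)/(h+i+1)) := by
        have : (h:ℝ)+i+1 ≠ 0 := by positivity
        field_simp
        exact h2
      rw [h4, pow_succ, ← mul_assoc]
      exact mul_le_mul h1 h3 hy0.le (by positivity)
  have h1 := hstep k le_rfl
  have h2 : y ^ k = Real.exp (-(4*k^2/h)) := by
    rw [hy, ← Real.exp_nat_mul]; congr 1; field_simp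
  rw [h2] at h1
  refine le_trans (mul_le_mul_of_nonneg_right ?_ (Real.exp_pos _).le) h1
  have h3 := Nat.four_pow_le_two_mul_self_mul_centralBinom h (by omega)
  rw [div_le_iff₀ (by positivity), mul_comm]
  unfold Nat.centralBinom at h3
  exact_mod_cast h3

lemma bin_upper (h k : ℕ) (hk : 1 ≤ k) (hkh : 2*k ≤ h) :
    ((2*h).choose (h+2*k) : ℝ) ≤ (2*h).choose (h+k) * Real.exp (-(k^2/h)) := by
  have hh : (0:ℝ) < h := by exact_mod_cast (by omega : 0 < h)
  have hk0 : (0:ℝ) < k := by exact_mod_cast (by omega : 0 < k)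
  have hkh' : 2*(k:ℝ) ≤ h := by exact_mod_cast hkh
  set y : ℝ := Real.exp (-(k/h)) with hy
  have hy0 : 0 < y := Real.exp_pos _
  have hyle : (h-k)/h ≤ y := by
    have := Real.add_one_le_exp (-((k:ℝ)/h))
    rw [sub_div, div_self hh.ne']
    linarith
  have hstep : ∀ i ≤ k, ((2*h).choose (h+(k+i)) : ℝ) ≤ (2*h).choose (h+k) * y ^ i := by
    intro i
    induction i with
    | zero => simp
    | succ i ih =>
      intro hi
      have h1 := ih (by omega)
      have h2 := bin_step h (k+i) (by omega)
      have hik : (i:ℝ) + 1 ≤ k := by exact_mod_cast hi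
      have hi0 : (0:ℝ) ≤ i := by positivity
      push_cast at h2
      have h3 : (h-(k+i):ℝ)/(h+(k+i)+1) ≤ y := by
        refine le_trans ?_ hyle
        apply div_le_div₀ <;> linarith
      have h4 : ((2*h).choose (h+(k+(i+1))) : ℝ)
          = (2*h).choose (h+(k+i)) * ((h-(k+i):ℝ)/(h+(k+i)+1)) := by
        have : (h:ℝ)+(k+i)+1 ≠ 0 := by positivity
        field_simp
        exact h2
      rw [h4, pow_succ, ← mul_assoc]
      exact mul_le_mul h1 h3 (div_nonneg (by linarith) (by positivity)) (by positivity)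
  have h1 := hstep k le_rfl
  have h2 : y ^ k = Real.exp (-(k^2/h)) := by
    rw [hy, ← Real.exp_nat_mul]; congr 1; field_simp
  rw [h2, ← two_mul] at h1
  exact h1

lemma tail_count (h w : ℕ) :
    (Finset.univ.filter fun A : Finset (Fin (2*h)) => ¬ (h < A.card + w ∧ A.card < h + w)).card
      ≤ (2*h+1) * (2*h).choose (h+w) := by
  classical
  have hsub : (Finset.univ.filter fun A : Finset (Fin (2*h)) =>
      ¬ (h < A.card + w ∧ A.card < h + w)) ⊆
      ((Finset.range (2*h+1)).filter fun j => ¬ (h < j + w ∧ j < h + w)).biUnion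
        fun j => Finset.powersetCard j Finset.univ := by
    intro A hA
    rw [Finset.mem_filter] at hA
    rw [Finset.mem_biUnion]
    refine ⟨A.card, ?_, by simp [Finset.mem_powersetCard]⟩
    rw [Finset.mem_filter, Finset.mem_range]
    refine ⟨?_, hA.2⟩
    have := Finset.card_le_univ A
    rw [Fintype.card_fin] at this
    omega
  refine (Finset.card_le_card hsub).trans ?_
  refine (Finset.card_biUnion_le_card_mul _ _ ((2*h).choose (h+w)) ?_).trans ?_
  · intro j hj
    rw [Finset.mem_filter, Finset.mem_range] at hj
    rw [Finset.card_powersetCard, Finset.card_univ, Fintype.card_fin]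
    rcases le_total h j with hjh | hjh
    · have := bin_anti h w (j - h) (by omega)
      rwa [Nat.add_sub_cancel' hjh] at this
    · rw [← Nat.choose_symm (by omega : j ≤ 2*h)]
      have := bin_anti h w (h - j) (by omega)
      rwa [show h + (h - j) = 2*h - j by omega] at this
  · refine Nat.mul_le_mul_right _ ?_
    refine (Finset.card_filter_le _ _).trans ?_
    simp

lemma comb {F : Type} [Field F] {K : Type} [Field K] [Algebra F K] {n : ℕ}
    {g : (Fin n → Bool) → Bool} {d k h J : ℕ} {ε : ℝ} (H : HasPoly F g d ε)
    (hJ : 2 * h + J ≤ n + 1) (sp : ℕ → K)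
    (hsp : ∀ a, (if g a then (1:K) else 0) = sp (wt a)) (c : Fin J → K) (z : K)
    (hz : z ≠ 1) (hz0 : z ≠ 0) (hdk : d < k) (W : Finset (Finset (Fin (2*h))))
    (hW : ∀ A ∉ W, ∑ j : Fin J, c j * sp (A.card + j) = z ^ A.card) :
    ((2*h).choose (h+k) : ℝ) ≤ J * ε * 4 ^ h + W.card := by
  classical
  obtain ⟨G, hG, Bad, hBad, hGB⟩ := core_restrict K H (2*h) J
  have key := smolensky_s15 z hz hz0 hdk (∑ j : Fin J, c j • G j)
    (Submodule.sum_mem _ fun j _ => Submodule.smul_mem _ _ (hG j)) (Bad ∪ W) (by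
      intro A hA
      rw [Finset.mem_union, not_or] at hA
      rw [← hW A hA.2, Finset.sum_apply]
      refine Finset.sum_congr rfl fun j _ => ?_
      rw [Pi.smul_apply, smul_eq_mul, hGB A hA.1 j j.2, hsp, wt_phiR]
      have := j.2
      omega)
  have h2 := key.trans (Finset.card_union_le _ _)
  have h3 : ((2*h).choose (h+k) : ℝ) ≤ Bad.card + W.card := by exact_mod_cast h2
  have h4 : (2:ℝ)^(2*h) = 4^h := by rw [pow_mul]; norm_num
  rw [h4] at hBad
  linarith

/-- final numeric contradiction -/
lemma num_contra {n h k J : ℕ} {lam : ℝ} (hn : 1 ≤ n) (hk : 1 ≤ k) (hkh : 2 * k ≤ h)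
    (hhJ : 4 * h * J ≤ n ^ 2) (hl : 4 * Real.log n ≤ lam)
    (hc : ((2*h).choose (h+k) : ℝ) ≤ 2 * (J * Real.exp (-lam) * 4 ^ h)) :
    h * lam ≤ 8 * k ^ 2 := by
  have hh : (0:ℝ) < h := by
    have : 0 < h := by omega
    exact_mod_cast this
  have hb := bin_lower h k hk hkh
  have h4 : (0:ℝ) < 4 ^ h := by positivity
  have e1 : Real.exp (-(4*k^2/h)) ≤ n^2 * Real.exp (-lam) := by
    have : (4:ℝ)^h/(2*h) * Real.exp (-(4*k^2/h)) ≤ 2 * (J * Real.exp (-lam) * 4 ^ h) := hb.trans hc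
    have h5 : Real.exp (-(4*k^2/h)) ≤ 4 * h * J * Real.exp (-lam) := by
      have h6 : (4:ℝ)^h/(2*h) * Real.exp (-(4*k^2/h)) = 4^h * (Real.exp (-(4*k^2/h)) / (2*h)) := by
        ring
      rw [h6, show 2 * (J * Real.exp (-lam) * 4 ^ h) = 4^h * (2 * (J * Real.exp (-lam))) by ring] at this
      have h7 := le_of_mul_le_mul_left this h4
      rw [div_le_iff₀ (by positivity)] at h7
      linarith
    refine h5.trans ?_
    have : (4 * h * J : ℝ) ≤ n^2 := by exact_mod_cast hhJ
    exact mul_le_mul_of_nonneg_right this (Real.exp_pos _).le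
  have hn0 : (0:ℝ) < n := by exact_mod_cast hn
  have e2 : (n:ℝ)^2 * Real.exp (-lam) = Real.exp (2 * Real.log n - lam) := by
    rw [sub_eq_add_neg, Real.exp_add, mul_comm 2, Real.exp_mul, Real.exp_log hn0]
    norm_num
  rw [e2, Real.exp_le_exp] at e1
  have e3 : lam / 2 ≤ 4*k^2/h := by linarith
  rw [le_div_iff₀ hh] at e3
  linarith

lemma period_props (n : ℕ) (spec : ℕ → Bool) (hb : 2 ≤ period n spec) :
    (∀ i, i + period n spec ≤ n → spec i = spec (i + period n spec)) ∧
    ∀ c, 1 ≤ c → (∀ i, i + c ≤ n → spec i = spec (i + c)) → period n spec ≤ c := by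
  refine ⟨?_, fun c h1 h2 => Nat.sInf_le ⟨h1, h2⟩⟩
  have hne : {b | 1 ≤ b ∧ ∀ i, i + b ≤ n → spec i = spec (i + b)}.Nonempty := by
    by_contra h
    rw [Set.not_nonempty_iff_eq_empty] at h
    unfold period at hb
    rw [h, Nat.sInf_empty] at hb
    omega
  exact (Nat.sInf_mem hne).2

lemma sp_setup (K : Type) [Field K] (n : ℕ) (spec : ℕ → Bool) (hb : 2 ≤ period n spec) :
    ∃ f : ℕ → K, (∀ i, f (i + period n spec) = f i) ∧
      (∀ c, 1 ≤ c → (∀ i, f (i + c) = f i) → period n spec ≤ c) ∧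
      (∀ i ≤ n, f i = if spec i then 1 else 0) ∧ ∀ i, f i = 0 ∨ f i = 1 := by
  obtain ⟨h1, h2⟩ := period_props n spec hb
  set b := period n spec
  have hag : ∀ i ≤ n, spec (i % b) = spec i := by
    intro i
    induction i using Nat.strong_induction_on with
    | _ i ih =>
      intro hi
      rcases lt_or_ge i b with h | h
      · rw [Nat.mod_eq_of_lt h]
      · obtain ⟨j, rfl⟩ := Nat.exists_eq_add_of_le' h
        rw [Nat.add_mod_right, ih j (by omega) (by omega), h1 j hi]
  refine ⟨fun i => if spec (i % b) then 1 else 0, fun i => by simp, ?_, ?_, ?_⟩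
  · intro c hc hper
    refine h2 c hc fun i hi => ?_
    have := hper i
    simp only [hag _ hi, hag i (by omega)] at this
    revert this
    cases spec i <;> cases spec (i+c) <;> simp
  · intro i hi
    simp only [hag i hi]
  · intro i
    simp only
    split_ifs <;> simp

lemma nonconst (n : ℕ) (spec : ℕ → Bool) (hb : 2 ≤ period n spec)
    (g : (Fin n → Bool) → Bool) (hg : ∀ a, g a = spec (wt a)) : ∃ a a', g a ≠ g a' := by
  by_contra hcon
  push Not at hcon
  have := (period_props n spec hb).2 1 le_rfl (by
    intro i hi
    have e := hcon (phiR n 0 i ∅) (phiR n 0 (i+1) ∅)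
    rw [hg, hg, wt_phiR _ _ _ (by omega), wt_phiR _ _ _ (by omega)] at e
    simpa using e)
  omega

lemma deg_le_of_periodic {K : Type} [Field K] (f : ℕ → K) (b : ℕ) (hb : 0 < b)
    (hf : ∀ i, f (i + b) = f i) :
    ∃ μ : Polynomial K, μ.Monic ∧ shiftAct μ f = 0 ∧ (∀ q, shiftAct q f = 0 → μ ∣ q) ∧
      μ.natDegree ≤ b := by
  have hX : (Polynomial.X ^ b - 1 : Polynomial K) ≠ 0 := by
    have := Polynomial.X_pow_sub_C_ne_zero hb (1:K)
    simpa using this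
  obtain ⟨μ, h1, h2, h3⟩ := exists_minAnn f _ hX (ann_of_periodic f b hf)
  refine ⟨μ, h1, h2, h3, ?_⟩
  have := Polynomial.natDegree_le_of_dvd (h3 _ (ann_of_periodic f b hf)) hX
  have e := Polynomial.natDegree_X_pow_sub_C (n := b) (r := (1:K))
  simp only [map_one] at e
  omega

lemma main_i {F : Type} [Field F] (p : ℕ) [CharP F p] (hp : p = 0 ∨ p.Prime) {n : ℕ}
    (hn : 256 ≤ n) (g : (Fin n → Bool) → Bool) (spec : ℕ → Bool)
    (hg : ∀ a, g a = spec (wt a)) (hb : 2 ≤ period n spec) (hb3 : period n spec ≤ n / 3)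
    (hnp : ¬ ∃ t, period n spec = p ^ t) {d k : ℕ} {lam : ℝ}
    (H : HasPoly F g d (Real.exp (-lam))) (hl : 32 * Real.log n ≤ lam) (hln : lam ≤ n)
    (hk1 : 20 * Real.log n ≤ k) (hk2 : 100 * (k:ℝ)^2 ≤ n * lam) : k ≤ d := by
  by_contra hdk
  push Not at hdk
  let K := AlgebraicClosure F
  have : CharP K p := charP_of_injective_algebraMap (algebraMap F K).injective p
  obtain ⟨f, f1, f2, f3, f4⟩ := sp_setup K n spec hb
  set b := period n spec with hbdef
  obtain ⟨μ, m1, m2, m3, m4⟩ := deg_le_of_periodic f b (by omega) f1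
  obtain ⟨z, z1, z0, zr⟩ := exists_root_ne_one p hp f b hb f1 f2 hnp μ m1 m2 m3
  obtain ⟨c, hc⟩ := geom_of_root f μ m1 m2 m3 z zr
  have hwt : ∀ a : Fin n → Bool, wt a ≤ n := fun a => by
    unfold wt
    exact (Finset.card_le_univ _).trans (by simp)
  have hlog : 0 < Real.log n := Real.log_pos (by exact_mod_cast (by omega : 1 < n))
  have hnR : (256:ℝ) ≤ n := by exact_mod_cast hn
  have hk0 : 1 ≤ k := by
    have : (0:ℝ) < k := by linarith
    exact_mod_cast this
  have hkn : 10 * k ≤ n := by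
    have : (10 * k : ℝ) ≤ n := by
      refine le_of_sq_le_sq ?_ (by positivity)
      nlinarith
    exact_mod_cast this
  have key := comb (h := n/3) H (by omega) f (fun a => by rw [f3 _ (hwt a), hg]) c z z1 z0 hdk ∅
    (fun A _ => hc A.card)
  simp only [Finset.card_empty, Nat.cast_zero, add_zero] at key
  have hJ : 4 * (n/3) * μ.natDegree ≤ n^2 := by
    have a1 : μ.natDegree ≤ n/3 := by omega
    have a2 : 3 * (n/3) ≤ n := by omega
    nlinarith
  have hpos : (0:ℝ) ≤ μ.natDegree * Real.exp (-lam) * 4 ^ (n/3) := by positivity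
  have fin := num_contra (n := n) (lam := lam) (by omega) hk0 (by omega) hJ (by linarith) (key.trans (by linarith))
  have hh : (n:ℝ) ≤ 4 * ((n/3 : ℕ):ℝ) := by exact_mod_cast (by omega : n ≤ 4 * (n/3))
  have hk0R : (1:ℝ) ≤ k := by exact_mod_cast hk0
  nlinarith

lemma main_ii {F : Type} [Field F] (p : ℕ) [CharP F p] (hp : p = 0 ∨ p.Prime) {n : ℕ}
    (hn : 256 ≤ n) (g : (Fin n → Bool) → Bool) (spec : ℕ → Bool)
    (hg : ∀ a, g a = spec (wt a)) (hb : 2 ≤ period n spec) (hb3 : period n spec ≤ n / 3)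
    (t : ℕ) (ht : period n spec = p ^ t) {d k : ℕ} {lam : ℝ}
    (H : HasPoly F g d (Real.exp (-lam))) (hl : 32 * Real.log n ≤ lam) (hln : lam ≤ n)
    (hk1 : 20 * Real.log n ≤ k) (hk2 : 100 * (k:ℝ)^2 ≤ n * lam)
    (hkb : 8 * k ≤ period n spec) : k ≤ d := by
  classical
  by_contra hdk
  push Not at hdk
  have hpp : p.Prime := by
    rcases hp with rfl | h
    · exfalso
      rcases Nat.eq_zero_or_pos t with rfl | h
      · simp at ht; omega
      · rw [zero_pow h.ne'] at ht; omega
    · exact h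
  have : Fact p.Prime := ⟨hpp⟩
  let K := AlgebraicClosure F
  have : CharP K p := charP_of_injective_algebraMap (algebraMap F K).injective p
  have : Infinite K := IsAlgClosed.instInfinite
  obtain ⟨f, f1, f2, f3, f4⟩ := sp_setup K n spec hb
  set b := period n spec with hbdef
  obtain ⟨μ, m1, m2, m3, m4⟩ := deg_le_of_periodic f b (by omega) f1
  have mb := (ann_degree_large p f f4 t b hb ht f1 f2 μ m1 m2 m3).1
  obtain ⟨z, hz⟩ := Infinite.exists_notMem_finset ({0, 1} : Finset K)
  simp only [Finset.mem_insert, Finset.mem_singleton, not_or] at hz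
  have hwt : ∀ a : Fin n → Bool, wt a ≤ n := fun a => by
    unfold wt
    exact (Finset.card_le_univ _).trans (by simp)
  have hlog : 0 < Real.log n := Real.log_pos (by exact_mod_cast (by omega : 1 < n))
  have hnR : (256:ℝ) ≤ n := by exact_mod_cast hn
  have hk0 : 1 ≤ k := by
    have : (0:ℝ) < k := by linarith
    exact_mod_cast this
  have hk0R : (1:ℝ) ≤ k := by exact_mod_cast hk0
  have hkn : 10 * k ≤ n := by
    have : (10 * k : ℝ) ≤ n := by
      refine le_of_sq_le_sq ?_ (by positivity)
      nlinarith
    exact_mod_cast this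
  set x : ℝ := (k:ℝ)^2 / (2 * Real.log n) with hx
  have hx10 : (10 * k : ℝ) ≤ x := by
    rw [hx, le_div_iff₀ (by positivity)]
    nlinarith
  have hxf : 10 * k ≤ ⌊x⌋₊ := Nat.le_floor (by exact_mod_cast hx10)
  set h : ℕ := min (n/3) ⌊x⌋₊ with hh
  have hhn : h ≤ n/3 := min_le_left _ _
  have hhx : (h:ℝ) ≤ x := by
    have a1 : (h:ℝ) ≤ (⌊x⌋₊ : ℝ) := by exact_mod_cast min_le_right _ _
    exact a1.trans (Nat.floor_le (by linarith))
  have hkh : 2 * k ≤ h := le_min (by omega) (by omega)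
  have hh0 : (0:ℝ) < h := by exact_mod_cast (by omega : 0 < h)
  obtain ⟨c, hc⟩ := window_interp f b (by omega) f1 μ m1 m2 m3 (h - 2*k + 1)
    (fun i => z ^ (h - 2*k + 1 + i))
  have key := comb (h := h) H (by omega) f (fun a => by rw [f3 _ (hwt a), hg]) c z hz.2 hz.1 hdk
    (Finset.univ.filter fun A : Finset (Fin (2*h)) => ¬ (h < A.card + 2*k ∧ A.card < h + 2*k))
    (by
      intro A hA
      simp only [Finset.mem_filter, Finset.mem_univ, true_and, not_not] at hA
      have := hc (A.card - (h - 2*k + 1)) (by omega)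
      have e : h - 2*k + 1 + (A.card - (h - 2*k + 1)) = A.card := by omega
      simpa only [e] using this)
  have tc : ((Finset.univ.filter fun A : Finset (Fin (2*h)) =>
      ¬ (h < A.card + 2*k ∧ A.card < h + 2*k)).card : ℝ) ≤ (2*h+1) * (2*h).choose (h+2*k) := by
    exact_mod_cast tail_count h (2*k)
  have bu := bin_upper h k hk0 hkh
  have ex : (2*h+1) * Real.exp (-((k:ℝ)^2/h)) ≤ 1/2 := by
    have e1 : 2 * Real.log n ≤ (k:ℝ)^2/h := by
      rw [le_div_iff₀ hh0]
      rw [hx, le_div_iff₀ (by positivity)] at hhx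
      linarith
    have e2 : Real.exp (-((k:ℝ)^2/h)) ≤ 1 / (n:ℝ)^2 := by
      calc Real.exp (-((k:ℝ)^2/h)) ≤ Real.exp (-(Real.log n * 2)) := Real.exp_le_exp.2 (by linarith)
        _ = 1 / (n:ℝ)^2 := by
          rw [Real.exp_neg, Real.exp_mul, Real.exp_log (by linarith)]
          norm_num
    have e3 : (2*h+1 : ℝ) ≤ n := by exact_mod_cast (by omega : 2*h+1 ≤ n)
    calc (2*h+1) * Real.exp (-((k:ℝ)^2/h)) ≤ n * (1/(n:ℝ)^2) :=
          mul_le_mul e3 e2 (Real.exp_pos _).le (by positivity)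
      _ = 1 / n := by field_simp
      _ ≤ 1/2 := one_div_le_one_div_of_le (by norm_num) (by linarith)
  have tc2 : (2*h+1 : ℝ) * (2*h).choose (h+2*k) ≤ (2*h).choose (h+k) * (1/2) := by
    calc (2*h+1 : ℝ) * (2*h).choose (h+2*k)
        ≤ (2*h+1) * ((2*h).choose (h+k) * Real.exp (-(k^2/h))) :=
          mul_le_mul_of_nonneg_left bu (by positivity)
      _ = (2*h).choose (h+k) * ((2*h+1) * Real.exp (-((k:ℝ)^2/h))) := by ring
      _ ≤ _ := mul_le_mul_of_nonneg_left ex (by positivity)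
  have hJ : 4 * h * μ.natDegree ≤ n^2 := by
    have a1 : μ.natDegree ≤ n/3 := by omega
    have a2 : 3 * (n/3) ≤ n := by omega
    nlinarith
  have fin := num_contra (n := n) (lam := lam) (by omega) hk0 hkh hJ (by linarith)
    (by linarith)
  rcases le_total (n/3) ⌊x⌋₊ with hc1 | hc1
  · have he : h = n/3 := min_eq_left hc1
    have hh : (n:ℝ) ≤ 4 * (h:ℝ) := by exact_mod_cast (by omega : n ≤ 4 * h)
    nlinarith
  · have he : h = ⌊x⌋₊ := min_eq_right hc1
    have hlt : x < 2 * h := by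
      have a1 := Nat.lt_floor_add_one x
      rw [← he] at a1
      have a2 : (1:ℝ) ≤ h := by exact_mod_cast (by omega : 1 ≤ h)
      linarith
    rw [hx, div_lt_iff₀ (by positivity)] at hlt
    nlinarith

/-- corollary with real parameter -/
lemma main_cor {F : Type} [Field F] (p : ℕ) [CharP F p] (hp : p = 0 ∨ p.Prime) {n : ℕ}
    (hn : 256 ≤ n) (g : (Fin n → Bool) → Bool) (spec : ℕ → Bool)
    (hg : ∀ a, g a = spec (wt a)) (hb : 2 ≤ period n spec) (hb3 : period n spec ≤ n / 3)
    {d : ℕ} {lam X : ℝ} (hd : 1 ≤ d)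
    (H : HasPoly F g d (Real.exp (-lam))) (hl : 32 * Real.log n ≤ lam) (hln : lam ≤ n)
    (hX0 : 0 ≤ X) (hX : X ^ 2 ≤ n * lam)
    (hXb : (∃ t, period n spec = p ^ t) → X ≤ period n spec) :
    X ≤ 20 * d ∨ X ≤ 210 * Real.log n := by
  have hlog : 1 ≤ Real.log n := by
    rw [Real.le_log_iff_exp_le (by positivity)]
    have : (256:ℝ) ≤ n := by exact_mod_cast hn
    linarith [Real.exp_one_lt_d9]
  set k := ⌊X/10⌋₊ with hk
  have k1 : (k:ℝ) ≤ X/10 := Nat.floor_le (by positivity)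
  have k2 : X/10 < k + 1 := Nat.lt_floor_add_one _
  have hdR : (1:ℝ) ≤ d := by exact_mod_cast hd
  rcases lt_or_ge (k:ℝ) (20 * Real.log n) with h | h
  · right; linarith
  · left
    have hk2 : 100 * (k:ℝ)^2 ≤ n * lam := by
      have : (0:ℝ) ≤ k := by positivity
      nlinarith
    have hkd : k ≤ d := by
      by_cases hpow : ∃ t, period n spec = p ^ t
      · obtain ⟨t, ht⟩ := hpow
        refine main_ii p hp hn g spec hg hb hb3 t ht H hl hln h hk2 ?_
        have := hXb ⟨t, ht⟩
        have : (8 * k : ℝ) ≤ period n spec := by linarith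
        exact_mod_cast this
      · exact main_i p hp hn g spec hg hb hb3 hpow H hl hln h hk2
    have : (k:ℝ) ≤ d := by exact_mod_cast hkd
    linarith

lemma log_le_lin {n : ℕ} (hn : 256 ≤ n) : 32 * Real.log n ≤ n := by
  have hnR : (256:ℝ) ≤ n := by exact_mod_cast hn
  have e : Real.log n = 8 * Real.log 2 + Real.log (n/256) := by
    rw [Real.log_div (by linarith) (by norm_num), show (256:ℝ) = 2^8 by norm_num, Real.log_pow]
    push_cast; ring
  have h1 := Real.log_two_lt_d9
  have h2 := Real.log_le_sub_one_of_pos (show (0:ℝ) < n/256 by linarith)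
  linarith

lemma amp_choose {F : Type} [Field F] {n : ℕ} {g : (Fin n → Bool) → Bool} {d : ℕ}
    (H : HasPoly F g d (1/3)) {l : ℝ} (hl : 1 ≤ l) :
    ∃ D : ℕ, d ≤ D ∧ (D:ℝ) ≤ 186624 * l^2 * d ∧ HasPoly F g D (Real.exp (-(32 * l))) := by
  obtain ⟨t, t1, t2⟩ := exists_nat_pow_near (show (1:ℝ) ≤ 144 * l by linarith) one_lt_two
  refine ⟨3^(t+1+1) * d, Nat.le_mul_of_pos_left _ (by positivity), ?_,
    (H.amp_iter (t+1)).mono ?_⟩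
  · push_cast
    refine mul_le_mul_of_nonneg_right ?_ (by positivity)
    have h1 : (3:ℝ)^t ≤ (2^t)^2 := by
      rw [← pow_mul, mul_comm, pow_mul]
      exact pow_le_pow_left₀ (by norm_num) (by norm_num) _
    have h2 : ((2:ℝ)^t)^2 ≤ (144*l)^2 := pow_le_pow_left₀ (by positivity) t1 2
    rw [pow_succ, pow_succ]
    nlinarith
  · have h1 : (7/9:ℝ) ≤ Real.exp (-(2/9)) := by
      have := Real.add_one_le_exp (-(2/9:ℝ))
      linarith
    have h2 : (7/9:ℝ)^(2^(t+1)) ≤ Real.exp (-(2/9))^(2^(t+1)) :=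
      pow_le_pow_left₀ (by norm_num) h1 _
    rw [← Real.exp_nat_mul] at h2
    have h3 : Real.exp (((2^(t+1) : ℕ):ℝ) * -(2/9)) ≤ Real.exp (-(32*l)) := by
      rw [Real.exp_le_exp]
      push_cast
      linarith
    have h0 : 0 ≤ (7/9:ℝ)^(2^(t+1)) := by positivity
    linarith

lemma final_core {F : Type} [Field F] (p : ℕ) [CharP F p] (hp : p = 0 ∨ p.Prime) {n : ℕ}
    (hn : 2 ≤ n) (g : (Fin n → Bool) → Bool) (spec : ℕ → Bool)
    (hg : ∀ a, g a = spec (wt a)) (hb : 2 ≤ period n spec) (hb3 : period n spec ≤ n / 3)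
    (ε : ℝ) (he : 1 / (2:ℝ)^n ≤ ε) (he3 : ε ≤ 1/3) (T : ℝ) (hT0 : 0 ≤ T)
    (hT : T ≤ Real.sqrt (n * Real.logb 2 (1/ε)))
    (hTb : (∃ t, period n spec = p ^ t) → T ≤ period n spec) :
    1 / 10^7 * T / (Real.logb 2 n)^2 ≤ (pdeg F g ε : ℝ) := by
  have hε0 : 0 < ε := lt_of_lt_of_le (by positivity) he
  have hnR : (2:ℝ) ≤ n := by exact_mod_cast hn
  have H := pdeg_spec_s15 F g ε hε0.le
  set d := pdeg F g ε
  obtain ⟨a, a', haa⟩ := nonconst n spec hb g hg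
  have hd : 1 ≤ d := trivial_bound H he3 a a' haa
  have hdR : (1:ℝ) ≤ d := by exact_mod_cast hd
  have hl2a := Real.log_two_gt_d9
  have hl2b := Real.log_two_lt_d9
  set l := Real.logb 2 n with hldef
  have hl1 : 1 ≤ l := by
    rw [hldef, Real.le_logb_iff_rpow_le (by norm_num) (by linarith)]
    simpa using hnR
  have hlogl : Real.log n ≤ l := by
    have : Real.log n = l * Real.log 2 := by
      rw [hldef, Real.logb, div_mul_cancel₀ _ (by linarith)]
    nlinarith
  set M := Real.logb 2 (1/ε) with hM
  have hlam : Real.log (1/ε) = M * Real.log 2 := by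
    rw [hM, Real.logb, div_mul_cancel₀ _ (by linarith)]
  have hM0 : 0 ≤ M := Real.logb_nonneg (by norm_num) (by
    rw [le_div_iff₀ hε0]; linarith)
  have hMn : M ≤ n := by
    rw [hM, Real.logb_le_iff_le_rpow (by norm_num) (by positivity), Real.rpow_natCast]
    rw [div_le_iff₀ (by positivity)] at he
    rw [div_le_iff₀ hε0]
    linarith
  have hT2 : T^2 ≤ n * M := by
    have h1 := pow_le_pow_left₀ hT0 hT 2
    rwa [Real.sq_sqrt (by positivity)] at h1
  suffices hs : T ≤ 10^7 * (l^2 * d) by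
    rw [div_le_iff₀ (by positivity)]
    linarith
  have hl2 : l ≤ l^2 := by nlinarith
  have hld : l^2 ≤ l^2 * d := by nlinarith
  rcases lt_or_ge n 256 with hsm | hbig
  · have hTn : T ≤ n := by
      refine le_of_sq_le_sq ?_ (by positivity)
      nlinarith
    have : (n:ℝ) < 256 := by exact_mod_cast hsm
    linarith
  set lam := Real.log (1/ε) with hlamd
  have hexp : Real.exp (-lam) = ε := by
    rw [hlamd, one_div, Real.log_inv, neg_neg, Real.exp_log hε0]
  have hX : (T/2)^2 ≤ n * lam := by
    rw [hlam]
    have : 0 ≤ (n:ℝ) * M := by positivity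
    nlinarith
  have hXb : (∃ t, period n spec = p ^ t) → T/2 ≤ period n spec := fun h => by
    linarith [hTb h]
  rcases le_or_gt (32 * Real.log n) lam with hc | hc
  · have := main_cor p hp hbig g spec hg hb hb3 hd (by rwa [hexp]) hc
      (by rw [hlam]; nlinarith) (by linarith : 0 ≤ T/2) hX hXb
    rcases this with h | h
    · nlinarith
    · linarith
  · have hlog1 : 1 ≤ Real.log n := by
      rw [Real.le_log_iff_exp_le (by positivity)]
      have : (256:ℝ) ≤ n := by exact_mod_cast hbig
      linarith [Real.exp_one_lt_d9]
    obtain ⟨D, D1, D2, HD⟩ := amp_choose (H.mono he3) hlog1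
    have := main_cor p hp hbig g spec hg hb hb3 (hd.trans D1) HD le_rfl
      (log_le_lin hbig) (by linarith : 0 ≤ T/2) (hX.trans (by nlinarith)) hXb
    rcases this with h | h
    · have h5 : Real.log n ^ 2 ≤ l^2 := pow_le_pow_left₀ (by linarith) hlogl 2
      have h6 : Real.log n ^ 2 * d ≤ l^2 * d := mul_le_mul_of_nonneg_right h5 (by linarith)
      nlinarith
    · linarith

/-- lower bound for periodic symmetric functions `g` with
`2 ≤ per(g) ≤ ⌊n/3⌋`: case (i) `per(g)` not a power of `p`, case (ii) a power
of `p`. -/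
theorem stmt15 :
    ∃ c : ℝ, 0 < c ∧
      ∀ (F : Type) [Field F] (p : ℕ) [CharP F p], (p = 0 ∨ p.Prime) →
        ∀ n : ℕ, 2 ≤ n →
          ∀ (g : (Fin n → Bool) → Bool) (spec : ℕ → Bool),
            (∀ a, g a = spec (wt a)) →
            2 ≤ period n spec → period n spec ≤ n / 3 →
            ∀ ε : ℝ, 1 / (2:ℝ)^n ≤ ε → ε ≤ 1/3 →
              ((¬ (∃ t : ℕ, period n spec = p ^ t)) →
                c * Real.sqrt (n * Real.logb 2 (1/ε)) / (Real.logb 2 n)^2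
                  ≤ (pdeg F g ε : ℝ)) ∧
              ((∃ t : ℕ, period n spec = p ^ t) →
                c * min (period n spec : ℝ) (Real.sqrt (n * Real.logb 2 (1/ε)))
                    / (Real.logb 2 n)^2
                  ≤ (pdeg F g ε : ℝ)) := by
  refine ⟨1 / 10^7, by positivity, ?_⟩
  intro F _ p _ hp n hn g spec hg hb hb3 ε he he3
  refine ⟨fun hnp => ?_, fun hpow => ?_⟩
  · exact final_core p hp hn g spec hg hb hb3 ε he he3 _ (Real.sqrt_nonneg _) le_rfl
      (fun h => absurd h hnp)
  · exact final_core p hp hn g spec hg hb hb3 ε he he3 _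
      (le_min (by positivity) (Real.sqrt_nonneg _)) (min_le_right _ _) (fun _ => min_le_left _ _)
end
end
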